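/- Let m be a positive integer. On the quotient space Q₂ := 𝔈/𝔏₂, consider the operators induced by φ(u) := (∂₁u − m·z₁^{−m−1}·u, ∂₂u) and ψ(ω₁, ω₂) := ∂₁ω₂ − m·z₁^{−m−1}·ω₂ − ∂₂ω₁. Then: (i) φ and ψ map 𝔏₂ (respectively 𝔏₂ ⊕ 𝔏₂) into 𝔏₂ ⊕ 𝔏₂ (respectively 𝔏₂), so they descend to maps φ̄ : Q₂ → Q₂ ⊕ Q₂ and ψ̄ : Q₂ ⊕ Q₂ → Q₂ with ψ̄ ∘ φ̄ = 0; (ii) dim ker φ̄ = m; (iii) dim((ker ψ̄)/(im φ̄)) = m; (iv) ψ̄ is surjective. -/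

import Mathlib

/-- `A = {z ∈ ℂ² : z₁ ≠ 0 and z₂ ≠ 0}`. -/
def Aset : Set (ℂ × ℂ) := {z | z.1 ≠ 0 ∧ z.2 ≠ 0}

/-- Representatives of germs in `𝔈`: total functions that are holomorphic on
`V ∩ A` for some open neighbourhood `V` of the origin. -/
def Esp : Set (ℂ × ℂ → ℂ) :=
  {f | ∃ V : Set (ℂ × ℂ), IsOpen V ∧ ((0 : ℂ), (0 : ℂ)) ∈ V ∧
    DifferentiableOn ℂ f (V ∩ Aset)}

/-- Representatives of germs in `𝔏₂`: for some `N`, `z₁^N·f` extends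
holomorphically to `V ∩ {z₂ ≠ 0}`. -/
def L2set : Set (ℂ × ℂ → ℂ) :=
  {f | ∃ V : Set (ℂ × ℂ), IsOpen V ∧ ((0 : ℂ), (0 : ℂ)) ∈ V ∧
    ∃ (N : ℕ) (g : ℂ × ℂ → ℂ),
      DifferentiableOn ℂ g (V ∩ {z : ℂ × ℂ | z.2 ≠ 0}) ∧
      ∀ z ∈ V ∩ Aset, g z = z.1 ^ N * f z}

/-- First complex partial derivative. -/
noncomputable def pd1 (f : ℂ × ℂ → ℂ) : ℂ × ℂ → ℂ :=
  fun x => deriv (fun w => f (w, x.2)) x.1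

/-- Second complex partial derivative. -/
noncomputable def pd2 (f : ℂ × ℂ → ℂ) : ℂ × ℂ → ℂ :=
  fun x => deriv (fun w => f (x.1, w)) x.2

/-- First component of `φ(u) = (∂₁u − m·z₁^{−m−1}u, ∂₂u)`. -/
noncomputable def φ1 (m : ℕ) (u : ℂ × ℂ → ℂ) : ℂ × ℂ → ℂ :=
  fun x => pd1 u x - (m : ℂ) * x.1 ^ (-(m : ℤ) - 1) * u x

/-- Second component of `φ`. -/
noncomputable def φ2 (u : ℂ × ℂ → ℂ) : ℂ × ℂ → ℂ :=
  fun x => pd2 u x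

/-- `ψ(ω₁,ω₂) = ∂₁ω₂ − m·z₁^{−m−1}·ω₂ − ∂₂ω₁`. -/
noncomputable def ψop (m : ℕ) (ω₁ ω₂ : ℂ × ℂ → ℂ) : ℂ × ℂ → ℂ :=
  fun x => pd1 ω₂ x - (m : ℂ) * x.1 ^ (-(m : ℤ) - 1) * ω₂ x - pd2 ω₁ x

section

open Set Filter Topology Metric Function

/-! ### Circle integrals depending on a parameter -/

theorem continuousOn_circleIntegral_param {X : Type*} [TopologicalSpace X]
    {U : Set X} {F : X → ℂ → ℂ} {c : ℂ} {R : ℝ} (hR : 0 ≤ R)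
    (hF : ContinuousOn (uncurry F) (U ×ˢ sphere c R)) :
    ContinuousOn (fun x => ∮ w in C(c, R), F x w) U := by
  rw [continuousOn_iff_continuous_domRestrict]
  unfold circleIntegral
  refine intervalIntegral.continuous_parametric_intervalIntegral_of_continuous'
    (f := fun (x : U) θ => deriv (circleMap c R) θ • F x (circleMap c R θ)) ?_ 0 (2 * Real.pi)
  have h : Continuous fun p : U × ℝ => uncurry F ((p.1 : X), circleMap c R p.2) :=
    hF.comp_continuous (by fun_prop) fun p => ⟨p.1.2, circleMap_mem_sphere c hR p.2⟩
  simp only [deriv_circleMap]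
  exact Continuous.smul (f := fun p : U × ℝ => circleMap 0 R p.2 * Complex.I) (by fun_prop) h

theorem continuousOn_deriv_param {X : Type*} [TopologicalSpace X]
    {U : Set ℂ} (hU : IsOpen U) {T : Set X} {F : ℂ → X → ℂ}
    (hF : ContinuousOn (uncurry F) (U ×ˢ T))
    (hd : ∀ t ∈ T, DifferentiableOn ℂ (fun z => F z t) U) :
    ContinuousOn (fun p : ℂ × X => deriv (fun z => F z p.2) p.1) (U ×ˢ T) := by
  rintro ⟨z₀, t₀⟩ ⟨hz₀, ht₀⟩
  obtain ⟨r, hr, hball⟩ := nhds_basis_closedBall.mem_iff.1 (hU.mem_nhds hz₀)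
  have hcont : ContinuousOn (fun p : ℂ × X =>
      ∮ w in C(z₀, r), ((w - p.1) ^ 2)⁻¹ * F w p.2) (ball z₀ r ×ˢ T) := by
    refine continuousOn_circleIntegral_param hr.le ?_
    refine ContinuousOn.mul (ContinuousOn.inv₀ (by fun_prop) ?_) ?_
    · rintro ⟨⟨z, t⟩, w⟩ ⟨⟨hz, ht⟩, hw⟩
      refine pow_ne_zero _ (sub_ne_zero.2 ?_)
      intro h
      simp only [mem_ball, mem_sphere] at hz hw h
      exact hz.ne (h ▸ hw)
    · refine hF.comp (f := fun q : (ℂ × X) × ℂ => (q.2, q.1.2)) (by fun_prop) ?_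
      rintro ⟨⟨z, t⟩, w⟩ ⟨⟨hz, ht⟩, hw⟩
      exact ⟨hball (sphere_subset_closedBall hw), ht⟩
  have hmem : (ball z₀ r ×ˢ (univ : Set X)) ∈ 𝓝 (z₀, t₀) :=
    prod_mem_nhds (ball_mem_nhds z₀ hr) univ_mem
  have hkey : ContinuousOn (fun p : ℂ × X => deriv (fun z => F z p.2) p.1) (ball z₀ r ×ˢ T) := by
    refine (hcont.const_smul ((2 * Real.pi * Complex.I : ℂ)⁻¹)).congr ?_
    rintro ⟨z, t⟩ ⟨hz, ht⟩
    have := Complex.two_pi_I_inv_smul_circleIntegral_sub_sq_inv_smul_of_differentiable hU hball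
      (hd t ht) hz
    simpa using this.symm
  refine (hkey (z₀, t₀) ⟨mem_ball_self hr, ht₀⟩).mono_of_mem_nhdsWithin ?_
  filter_upwards [mem_nhdsWithin_of_mem_nhds hmem, self_mem_nhdsWithin] with p h1 h2
  exact ⟨h1.1, h2.2⟩

theorem hasDerivAt_circleIntegral_param {U : Set ℂ} (hU : IsOpen U) {F : ℂ → ℂ → ℂ}
    {c : ℂ} {R : ℝ} (hR : 0 ≤ R) (hF : ContinuousOn (uncurry F) (U ×ˢ sphere c R))
    (hd : ∀ w ∈ sphere c R, DifferentiableOn ℂ (fun z => F z w) U) {z₀ : ℂ} (hz₀ : z₀ ∈ U) :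
    HasDerivAt (fun z => ∮ w in C(c, R), F z w)
      (∮ w in C(c, R), deriv (fun z => F z w) z₀) z₀ := by
  obtain ⟨r, hr, hball⟩ := nhds_basis_closedBall.mem_iff.1 (hU.mem_nhds hz₀)
  have hdc := continuousOn_deriv_param hU hF hd
  obtain ⟨C, hC⟩ :=
    ((isCompact_closedBall z₀ r).prod (isCompact_sphere c R)).exists_bound_of_continuousOn
    (hdc.mono (prod_mono hball le_rfl))
  have hsph := circleMap_mem_sphere c hR
  have hcont : ∀ G : ℂ → ℂ, ContinuousOn G (sphere c R) →
      Continuous fun θ => deriv (circleMap c R) θ • G (circleMap c R θ) := by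
    intro G hG
    simp only [deriv_circleMap]
    exact Continuous.smul (f := fun θ => circleMap 0 R θ * Complex.I) (by fun_prop)
      (hG.comp_continuous (by fun_prop) hsph)
  have hs : ∀ z ∈ U, ContinuousOn (F z) (sphere c R) := fun z hz =>
    hF.comp (f := fun w => (z, w)) (by fun_prop) fun w hw => ⟨hz, hw⟩
  unfold circleIntegral
  refine (intervalIntegral.hasDerivAt_integral_of_dominated_loc_of_deriv_le
    (F := fun z θ => deriv (circleMap c R) θ • F z (circleMap c R θ))
    (F' := fun z θ => deriv (circleMap c R) θ • deriv (fun z => F z (circleMap c R θ)) z)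
    (bound := fun _ => R * C) (ball_mem_nhds z₀ hr) ?_ ?_ ?_ ?_ ?_ ?_).2
  · filter_upwards [hU.mem_nhds hz₀] with z hz
    exact (hcont _ (hs z hz)).aestronglyMeasurable
  · exact (hcont _ (hs z₀ hz₀)).intervalIntegrable _ _
  · refine (hcont (fun w => deriv (fun z => F z w) z₀) ?_).aestronglyMeasurable
    exact hdc.comp (f := fun w => (z₀, w)) (by fun_prop) fun w hw => ⟨hz₀, hw⟩
  · refine .of_forall fun θ _ z hz => ?_
    have := hC (z, circleMap c R θ) ⟨ball_subset_closedBall hz, hsph θ⟩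
    rw [norm_smul]
    refine mul_le_mul (by simp [deriv_circleMap, abs_of_nonneg hR]) this (norm_nonneg _) hR
  · exact intervalIntegrable_const
  · refine .of_forall fun θ _ z hz => ?_
    exact (((hd _ (hsph θ)).differentiableAt
      (hU.mem_nhds (hball (ball_subset_closedBall hz)))).hasDerivAt).fun_const_smul _

/-- Osgood's lemma in two variables. -/
theorem differentiableOn_of_continuousOn_of_separately {U : Set (ℂ × ℂ)} (hU : IsOpen U)
    {f : ℂ × ℂ → ℂ} (hf : ContinuousOn f U)
    (h₁ : ∀ z ∈ U, DifferentiableAt ℂ (fun w => f (w, z.2)) z.1)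
    (h₂ : ∀ z ∈ U, DifferentiableAt ℂ (fun w => f (z.1, w)) z.2) :
    DifferentiableOn ℂ f U := by
  rintro ⟨a, b⟩ hab
  obtain ⟨S, hS, T, hT, hST⟩ := mem_nhds_prod_iff.1 (hU.mem_nhds hab)
  obtain ⟨S', hS'S, hS'o, haS'⟩ := _root_.mem_nhds_iff.1 hS
  obtain ⟨T', hT'T, hT'o, hbT'⟩ := _root_.mem_nhds_iff.1 hT
  have hsub : S' ×ˢ T' ⊆ U := (prod_mono hS'S hT'T).trans hST
  have hnhds : S' ×ˢ T' ∈ 𝓝 (a, b) := (hS'o.prod hT'o).mem_nhds ⟨haS', hbT'⟩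
  have c₁ : ContinuousOn (fun p : ℂ × ℂ => deriv (fun z => f (z, p.2)) p.1) (S' ×ˢ T') :=
    continuousOn_deriv_param (F := fun z t => f (z, t)) hS'o (hf.mono hsub)
      fun t ht z hz => (h₁ (z, t) (hsub ⟨hz, ht⟩)).differentiableWithinAt
  have c₂ : ContinuousOn (fun p : ℂ × ℂ => deriv (fun z => f (p.1, z)) p.2) (S' ×ˢ T') := by
    have := continuousOn_deriv_param (F := fun z t => f (t, z)) (U := T') (T := S') hT'o
      ((hf.mono hsub).comp (f := Prod.swap) (by fun_prop) fun p hp => ⟨hp.2, hp.1⟩)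
      fun t ht z hz => (h₂ (t, z) (hsub ⟨ht, hz⟩)).differentiableWithinAt
    exact this.comp (f := Prod.swap) (by fun_prop) fun p hp => ⟨hp.2, hp.1⟩
  have key := hasStrictFDerivAt_uncurry_coprod (𝕜 := ℂ) (u := (a, b)) (f := fun z w => f (z, w))
    (f₁ := fun z w => ContinuousLinearMap.toSpanSingleton ℂ (deriv (fun z => f (z, w)) z))
    (f₂ := fun z w => ContinuousLinearMap.toSpanSingleton ℂ (deriv (fun w => f (z, w)) w))
    ?_ ?_ ?_ ?_
  · exact key.hasFDerivAt.differentiableAt.differentiableWithinAt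
  · filter_upwards [hnhds] with p hp
    exact (h₁ p (hsub hp)).hasDerivAt.hasFDerivAt
  · filter_upwards [hnhds] with p hp
    exact (h₂ p (hsub hp)).hasDerivAt.hasFDerivAt
  · exact ((ContinuousLinearMap.toSpanSingletonCLE (𝕜 := ℂ) (E := ℂ)).continuous.continuousAt).comp
      (c₁.continuousAt hnhds)
  · exact ((ContinuousLinearMap.toSpanSingletonCLE (𝕜 := ℂ) (E := ℂ)).continuous.continuousAt).comp
      (c₂.continuousAt hnhds)

theorem differentiableOn_circleIntegral_param {U : Set (ℂ × ℂ)} (hU : IsOpen U)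
    {F : ℂ × ℂ → ℂ → ℂ} {c : ℂ} {R : ℝ} (hR : 0 ≤ R)
    (hF : ContinuousOn (uncurry F) (U ×ˢ sphere c R))
    (hd : ∀ w ∈ sphere c R, DifferentiableOn ℂ (fun z => F z w) U) :
    DifferentiableOn ℂ (fun z => ∮ w in C(c, R), F z w) U := by
  refine differentiableOn_of_continuousOn_of_separately hU
    (continuousOn_circleIntegral_param hR hF) ?_ ?_
  · rintro ⟨a, b⟩ hab
    refine (hasDerivAt_circleIntegral_param (U := (fun z => (z, b)) ⁻¹' U)
      (F := fun z w => F (z, b) w)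
      (hU.preimage (by fun_prop)) hR ?_ ?_ hab).differentiableAt
    · exact hF.comp (f := fun p : ℂ × ℂ => ((p.1, b), p.2)) (by fun_prop)
        fun p hp => ⟨hp.1, hp.2⟩
    · exact fun w hw => (hd w hw).comp (f := fun z => (z, b)) (by fun_prop) fun z hz => hz
  · rintro ⟨a, b⟩ hab
    refine (hasDerivAt_circleIntegral_param (U := (fun z => (a, z)) ⁻¹' U)
      (F := fun z w => F (a, z) w)
      (hU.preimage (by fun_prop)) hR ?_ ?_ hab).differentiableAt
    · exact hF.comp (f := fun p : ℂ × ℂ => ((a, p.1), p.2)) (by fun_prop)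
        fun p hp => ⟨hp.1, hp.2⟩
    · exact fun w hw => (hd w hw).comp (f := fun z => (a, z)) (by fun_prop) fun z hz => hz

/-! ### Partial derivatives -/

theorem differentiableOn_pd1 {U : Set (ℂ × ℂ)} (hU : IsOpen U) {f : ℂ × ℂ → ℂ}
    (hf : DifferentiableOn ℂ f U) : DifferentiableOn ℂ (pd1 f) U := by
  rintro ⟨a, b⟩ hab
  obtain ⟨r, hr, hball⟩ := nhds_basis_closedBall.mem_iff.1 (hU.mem_nhds hab)
  rw [← closedBall_prod_same] at hball
  have hbo : IsOpen (ball a r ×ˢ ball b r) := isOpen_ball.prod isOpen_ball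
  have hcirc : DifferentiableOn ℂ (fun z : ℂ × ℂ =>
      ∮ w in C(a, r), ((w - z.1) ^ 2)⁻¹ * f (w, z.2)) (ball a r ×ˢ ball b r) := by
    have hne : ∀ z ∈ ball a r, ∀ w ∈ sphere a r, (w - z) ^ 2 ≠ 0 := by
      intro z hz w hw
      refine pow_ne_zero _ (sub_ne_zero.2 ?_)
      rintro rfl
      simp only [mem_ball, mem_sphere] at hz hw
      exact hz.ne hw
    refine differentiableOn_circleIntegral_param hbo hr.le ?_ ?_
    · refine ContinuousOn.mul (ContinuousOn.inv₀ (by fun_prop) ?_) ?_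
      · exact fun p hp => hne _ hp.1.1 _ hp.2
      · refine hf.continuousOn.comp (f := fun q : (ℂ × ℂ) × ℂ => (q.2, q.1.2)) (by fun_prop) ?_
        exact fun p hp => hball ⟨sphere_subset_closedBall hp.2, ball_subset_closedBall hp.1.2⟩
    · intro w hw
      refine DifferentiableOn.mul (DifferentiableOn.inv (by fun_prop) ?_) ?_
      · exact fun p hp => hne _ hp.1 _ hw
      · refine hf.comp (f := fun q : ℂ × ℂ => (w, q.2)) (by fun_prop) ?_
        exact fun p hp => hball ⟨sphere_subset_closedBall hw, ball_subset_closedBall hp.2⟩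
  have hkey : DifferentiableOn ℂ (pd1 f) (ball a r ×ˢ ball b r) := by
    refine (hcirc.const_smul ((2 * Real.pi * Complex.I : ℂ)⁻¹)).congr ?_
    rintro ⟨z, t⟩ ⟨hz, ht⟩
    have := Complex.two_pi_I_inv_smul_circleIntegral_sub_sq_inv_smul_of_differentiable
      (U := (fun w => (w, t)) ⁻¹' U) (f := fun w => f (w, t))
      (hU.preimage (by fun_prop)) (fun w hw => hball ⟨hw, ball_subset_closedBall ht⟩)
      (hf.comp (f := fun w => (w, t)) (by fun_prop) fun w hw => hw) hz
    simpa [pd1] using this.symm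
  exact (hkey.differentiableAt
    (hbo.mem_nhds ⟨mem_ball_self hr, mem_ball_self hr⟩)).differentiableWithinAt

theorem differentiableOn_pd2 {U : Set (ℂ × ℂ)} (hU : IsOpen U) {f : ℂ × ℂ → ℂ}
    (hf : DifferentiableOn ℂ f U) : DifferentiableOn ℂ (pd2 f) U := by
  have h := differentiableOn_pd1 (U := (fun z : ℂ × ℂ => (z.2, z.1)) ⁻¹' U)
    (f := fun z : ℂ × ℂ => f (z.2, z.1)) (hU.preimage (by fun_prop))
    (hf.comp (f := fun z : ℂ × ℂ => (z.2, z.1)) (by fun_prop) fun z hz => hz)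
  exact h.comp (f := fun z : ℂ × ℂ => (z.2, z.1)) (by fun_prop) fun z hz => hz

theorem hasDerivAt_pd1 {f : ℂ × ℂ → ℂ} {z : ℂ × ℂ} (hf : DifferentiableAt ℂ f z) :
    HasDerivAt (fun w => f (w, z.2)) (pd1 f z) z.1 :=
  (hf.comp (f := fun w => (w, z.2)) z.1 (by fun_prop)).hasDerivAt

theorem hasDerivAt_pd2 {f : ℂ × ℂ → ℂ} {z : ℂ × ℂ} (hf : DifferentiableAt ℂ f z) :
    HasDerivAt (fun w => f (z.1, w)) (pd2 f z) z.2 :=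
  (hf.comp (f := fun w => (z.1, w)) z.2 (by fun_prop)).hasDerivAt

theorem fderiv_apply_fst {f : ℂ × ℂ → ℂ} {z : ℂ × ℂ} (hf : DifferentiableAt ℂ f z) :
    fderiv ℂ f z (1, 0) = pd1 f z := by
  have h := HasFDerivAt.comp_hasDerivAt z.1 (f := fun w => (w, z.2)) (l := f) hf.hasFDerivAt
    ((hasDerivAt_id z.1).prodMk (hasDerivAt_const z.1 z.2))
  exact h.unique (hasDerivAt_pd1 hf)

theorem fderiv_apply_snd {f : ℂ × ℂ → ℂ} {z : ℂ × ℂ} (hf : DifferentiableAt ℂ f z) :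
    fderiv ℂ f z (0, 1) = pd2 f z := by
  have h := HasFDerivAt.comp_hasDerivAt z.2 (f := fun w => (z.1, w)) (l := f) hf.hasFDerivAt
    ((hasDerivAt_const z.2 z.1).prodMk (hasDerivAt_id z.2))
  exact h.unique (hasDerivAt_pd2 hf)

theorem pd1_pd2_comm {U : Set (ℂ × ℂ)} (hU : IsOpen U) {f : ℂ × ℂ → ℂ}
    (hf : DifferentiableOn ℂ f U) {z : ℂ × ℂ} (hz : z ∈ U) :
    pd1 (pd2 f) z = pd2 (pd1 f) z := by
  have hat : ∀ x ∈ U, DifferentiableAt ℂ f x := fun x hx => hf.differentiableAt (hU.mem_nhds hx)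
  have d1 : DifferentiableAt ℂ (pd1 f) z :=
    (differentiableOn_pd1 hU hf).differentiableAt (hU.mem_nhds hz)
  have d2 : DifferentiableAt ℂ (pd2 f) z :=
    (differentiableOn_pd2 hU hf).differentiableAt (hU.mem_nhds hz)
  let f' : ℂ × ℂ → (ℂ × ℂ →L[ℂ] ℂ) := fun x =>
    pd1 f x • ContinuousLinearMap.fst ℂ ℂ ℂ + pd2 f x • ContinuousLinearMap.snd ℂ ℂ ℂ
  have hf' : ∀ᶠ x in 𝓝 z, HasFDerivAt f (f' x) x := by
    filter_upwards [hU.mem_nhds hz] with x hx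
    convert (hat x hx).hasFDerivAt using 1
    ext
    · simp [f', fderiv_apply_fst (hat x hx)]
    · simp [f', fderiv_apply_snd (hat x hx)]
  have hf'' : HasFDerivAt f' _ z :=
    (d1.hasFDerivAt.smul_const (ContinuousLinearMap.fst ℂ ℂ ℂ)).add
      (d2.hasFDerivAt.smul_const (ContinuousLinearMap.snd ℂ ℂ ℂ))
  have h := second_derivative_symmetric_of_eventually hf' hf'' (1, 0) (0, 1)
  simpa [fderiv_apply_fst d2, fderiv_apply_snd d1] using h

/-! ### Holomorphic functions on a punctured disc -/

/-- The punctured disc of radius `ρ` around the origin. -/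
def puncturedBall (ρ : ℝ) : Set ℂ := ball 0 ρ \ {0}

theorem mem_puncturedBall {ρ : ℝ} {z : ℂ} : z ∈ puncturedBall ρ ↔ ‖z‖ < ρ ∧ z ≠ 0 := by
  simp [puncturedBall]

theorem isOpen_puncturedBall (ρ : ℝ) : IsOpen (puncturedBall ρ) :=
  isOpen_ball.sdiff isClosed_singleton

theorem sphere_subset_puncturedBall {ρ R : ℝ} (hR : 0 < R) (hRρ : R < ρ) :
    sphere (0 : ℂ) R ⊆ puncturedBall ρ := by
  intro z hz
  rw [mem_sphere_zero_iff_norm] at hz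
  exact mem_puncturedBall.2 ⟨hz ▸ hRρ, norm_pos_iff.1 (hz ▸ hR)⟩

theorem circleIntegral_eq_of_puncturedBall {ρ r R : ℝ} {f : ℂ → ℂ}
    (hf : DifferentiableOn ℂ f (puncturedBall ρ)) (hr : 0 < r) (hrR : r ≤ R) (hR : R < ρ) :
    (∮ w in C(0, R), f w) = ∮ w in C(0, r), f w := by
  have hsub : closedBall (0 : ℂ) R \ ball 0 r ⊆ puncturedBall ρ := by
    rintro z ⟨h1, h2⟩
    simp only [mem_closedBall_zero_iff, mem_ball_zero_iff, not_lt] at h1 h2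
    exact mem_puncturedBall.2 ⟨h1.trans_lt hR, norm_pos_iff.1 (hr.trans_le h2)⟩
  refine Complex.circleIntegral_eq_of_differentiable_on_annulus_off_countable hr hrR
    countable_empty (hf.continuousOn.mono hsub) fun z hz => ?_
  refine hf.differentiableAt ((isOpen_puncturedBall ρ).mem_nhds (hsub ?_))
  exact ⟨ball_subset_closedBall hz.1.1, fun h => hz.1.2 (ball_subset_closedBall h)⟩

/-- Cauchy's integral formula on an annulus. -/
theorem circleIntegral_sub_circleIntegral_eq {ρ r R : ℝ} {f : ℂ → ℂ}
    (hf : DifferentiableOn ℂ f (puncturedBall ρ)) {z : ℂ} (hr : 0 < r) (hrz : r < ‖z‖)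
    (hzR : ‖z‖ < R) (hR : R < ρ) :
    (∮ w in C(0, R), f w / (w - z)) + (∮ w in C(0, r), f w / (z - w)) =
      2 * Real.pi * Complex.I * f z := by
  have hz : z ∈ puncturedBall ρ :=
    mem_puncturedBall.2 ⟨hzR.trans hR, norm_pos_iff.1 (hr.trans hrz)⟩
  have hd : DifferentiableOn ℂ (dslope f z) (puncturedBall ρ) :=
    (Complex.differentiableOn_dslope ((isOpen_puncturedBall ρ).mem_nhds hz)).2 hf
  have hcirc := circleIntegral_eq_of_puncturedBall hd hr (hrz.trans hzR).le hR
  have hsplit : ∀ s : ℝ, 0 < s → s < ρ → ‖z‖ ≠ s → (∮ w in C(0, s), dslope f z w) =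
      (∮ w in C(0, s), f w / (w - z)) - f z * ∮ w in C(0, s), (w - z)⁻¹ := by
    intro s hs hsρ hzs
    have hne : ∀ w ∈ sphere (0 : ℂ) s, w - z ≠ 0 := by
      intro w hw h
      rw [sub_eq_zero.1 h, mem_sphere_zero_iff_norm] at hw
      exact hzs hw
    have hinv : ContinuousOn (fun w : ℂ => (w - z)⁻¹) (sphere 0 s) :=
      ContinuousOn.inv₀ (by fun_prop) hne
    have hfc : ContinuousOn f (sphere 0 s) :=
      hf.continuousOn.mono (sphere_subset_puncturedBall hs hsρ)
    rw [← circleIntegral.integral_const_mul, ← circleIntegral.integral_sub]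
    · refine circleIntegral.integral_congr hs.le fun w hw => ?_
      rw [dslope_of_ne _ (sub_ne_zero.1 (hne w hw)), slope_def_field]
      have := hne w hw
      field_simp
    · exact (hfc.div (by fun_prop) hne).circleIntegrable hs.le
    · exact (continuousOn_const.mul hinv).circleIntegrable hs.le
  have hin : (∮ w in C(0, R), (w - z)⁻¹) = 2 * Real.pi * Complex.I :=
    circleIntegral.integral_sub_inv_of_mem_ball (by simpa using hzR)
  have hout : (∮ w in C(0, r), (w - z)⁻¹) = 0 := by
    refine Complex.circleIntegral_eq_zero_of_differentiable_on_off_countable hr.le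
      countable_empty ?_ ?_
    · refine ContinuousOn.inv₀ (by fun_prop) fun w hw h => ?_
      rw [sub_eq_zero.1 h, mem_closedBall_zero_iff] at hw
      exact hrz.not_ge hw
    · intro w hw
      refine DifferentiableAt.inv (by fun_prop) fun h => ?_
      rw [sub_eq_zero.1 h] at hw
      exact hrz.not_ge (mem_ball_zero_iff.1 hw.1).le
  rw [hsplit R (hr.trans (hrz.trans hzR)) hR hzR.ne, hsplit r hr ((hrz.trans hzR).trans hR) hrz.ne',
    hin, hout] at hcirc
  have hneg : (∮ w in C(0, r), f w / (z - w)) = -∮ w in C(0, r), f w / (w - z) := by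
    rw [← neg_one_mul, ← circleIntegral.integral_const_mul]
    refine circleIntegral.integral_congr hr.le fun w _ => ?_
    rw [← neg_sub w z, div_neg, neg_one_mul]
  rw [hneg]
  linear_combination hcirc

/-- If the principal part of the Laurent expansion vanishes, the singularity is removable. -/
theorem exists_extension_of_circleIntegral_pow_eq_zero {ρ R : ℝ} {f : ℂ → ℂ} (hR₀ : 0 < R)
    (hR : R < ρ) (hf : DifferentiableOn ℂ f (puncturedBall ρ))
    (h : ∀ n : ℕ, (∮ w in C(0, R), f w * w ^ n) = 0) :
    ∃ g : ℂ → ℂ, DifferentiableOn ℂ g (ball 0 R) ∧ ∀ z ∈ puncturedBall R, g z = f z := by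
  refine ⟨fun z => (2 * Real.pi * Complex.I)⁻¹ * ∮ w in C(0, R), f w / (w - z), ?_, ?_⟩
  · refine DifferentiableOn.const_mul (fun z hz => ?_) _
    have hne : ∀ z ∈ ball (0 : ℂ) R, ∀ w ∈ sphere (0 : ℂ) R, w - z ≠ 0 := by
      intro z hz w hw h
      rw [sub_eq_zero.1 h, mem_sphere_zero_iff_norm] at hw
      exact (mem_ball_zero_iff.1 hz).ne hw
    have hfc : ContinuousOn f (sphere 0 R) :=
      hf.continuousOn.mono (sphere_subset_puncturedBall hR₀ hR)
    refine (hasDerivAt_circleIntegral_param (F := fun z w => f w / (w - z)) isOpen_ball hR₀.le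
      ?_ ?_ hz).differentiableAt.differentiableWithinAt
    · exact ContinuousOn.div (hfc.comp (f := Prod.snd) (by fun_prop) fun p hp => hp.2)
        (by fun_prop) fun p hp => hne _ hp.1 _ hp.2
    · exact fun w hw => DifferentiableOn.div (by fun_prop) (by fun_prop) fun z hz => hne z hz w hw
  · intro z hz
    obtain ⟨hzR, hz0⟩ := mem_puncturedBall.1 hz
    have hzpos : 0 < ‖z‖ := norm_pos_iff.2 hz0
    have hr : 0 < ‖z‖ / 2 := by positivity
    set r := ‖z‖ / 2 with hrdef
    have hrz : r < ‖z‖ := by linarith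
    have hform := circleIntegral_sub_circleIntegral_eq hf hr hrz hzR hR
    have hfc : ContinuousOn f (sphere 0 r) :=
      hf.continuousOn.mono (sphere_subset_puncturedBall hr (hrz.trans (hzR.trans hR)))
    have hne : ∀ w ∈ sphere (0 : ℂ) r, z - w ≠ 0 := by
      intro w hw h
      rw [← sub_eq_zero.1 h, mem_sphere_zero_iff_norm] at hw
      exact hrz.ne' hw
    have hr0 : ∀ n : ℕ, (∮ w in C(0, r), f w * w ^ n) = 0 := fun n => by
      refine Eq.trans ?_ (h n)
      exact (circleIntegral_eq_of_puncturedBall (f := fun w => f w * w ^ n)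
        (hf.mul (differentiableOn_id.pow n)) hr
        (hrz.trans hzR).le hR).symm
    have hshift : ∀ n : ℕ, (∮ w in C(0, r), f w / (z - w)) =
        ∮ w in C(0, r), f w / (z - w) * (w / z) ^ n := by
      intro n
      induction n with
      | zero => simp
      | succ n ih =>
        rw [ih, ← sub_eq_zero, ← circleIntegral.integral_sub]
        · refine Eq.trans ?_ ((congrArg ((z ^ (n + 1))⁻¹ * ·) (hr0 n)).trans (mul_zero _))
          rw [← circleIntegral.integral_const_mul]
          refine circleIntegral.integral_congr hr.le fun w hw => ?_
          have := hne w hw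
          simp only [div_pow, pow_succ]
          field_simp
        · exact ((hfc.div (by fun_prop) hne).mul (by fun_prop)).circleIntegrable hr.le
        · exact ((hfc.div (by fun_prop) hne).mul (by fun_prop)).circleIntegrable hr.le
    obtain ⟨C, hC⟩ := (isCompact_sphere (0 : ℂ) r).exists_bound_of_continuousOn
      (hfc.div (by fun_prop) hne)
    have hzero : (∮ w in C(0, r), f w / (z - w)) = 0 := by
      have hlim : Tendsto (fun n : ℕ => 2 * Real.pi * r * (C * (1 / 2) ^ n)) atTop (𝓝 0) := by
        have := ((tendsto_pow_atTop_nhds_zero_of_lt_one (r := (1 / 2 : ℝ)) (by norm_num)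
          (by norm_num)).const_mul C).const_mul (2 * Real.pi * r)
        simpa using this
      refine norm_le_zero_iff.1 (ge_of_tendsto' hlim fun n => ?_)
      rw [hshift n]
      refine circleIntegral.norm_integral_le_of_norm_le_const hr.le fun w hw => ?_
      rw [norm_mul, norm_pow, norm_div w z, mem_sphere_zero_iff_norm.1 hw]
      have h12 : r / ‖z‖ = 1 / 2 := by rw [hrdef]; field_simp
      rw [h12]
      exact mul_le_mul_of_nonneg_right (hC w hw) (by positivity)
    rw [hzero, add_zero] at hform
    simp only [hform]
    have := Complex.two_pi_I_ne_zero
    field_simp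

/-! ### Residue and primitive in the second variable -/

/-- The residue at the origin in the second variable, computed on the circle of radius `R`. -/
noncomputable def res2 (R : ℝ) (u : ℂ × ℂ → ℂ) (x : ℂ) : ℂ :=
  (2 * Real.pi * Complex.I)⁻¹ * ∮ w in C(0, R), u (x, w)

/-- An integral operator which inverts `∂₂` up to the residue: the regular part of the Laurent
expansion is integrated with the kernel `-log (1 - z₂ / w)`, the principal part with the kernel
`log (1 - w / z₂)`. -/
noncomputable def prim2 (R : ℝ) (u : ℂ × ℂ → ℂ) (z : ℂ × ℂ) : ℂ :=
  (2 * Real.pi * Complex.I)⁻¹ *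
    ((∮ w in C(0, ‖z.2‖ / 2), u (z.1, w) * Complex.log (1 - w / z.2)) -
      ∮ w in C(0, R), u (z.1, w) * Complex.log (1 - z.2 / w))

theorem one_sub_div_mem_slitPlane {a b : ℂ} (h : ‖a‖ < ‖b‖) : 1 - a / b ∈ Complex.slitPlane := by
  rw [sub_eq_add_neg]
  refine Complex.mem_slitPlane_of_norm_lt_one ?_
  rw [norm_neg, norm_div]
  exact (div_lt_one ((norm_nonneg a).trans_lt h)).2 h

section

variable {S : Set ℂ} {ρ R r : ℝ} {u : ℂ × ℂ → ℂ}

theorem differentiableOn_slice (hu : DifferentiableOn ℂ u (S ×ˢ puncturedBall ρ)) {x : ℂ}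
    (hx : x ∈ S) : DifferentiableOn ℂ (fun w => u (x, w)) (puncturedBall ρ) :=
  hu.comp (f := fun w => (x, w)) (by fun_prop) fun _ hw => ⟨hx, hw⟩

theorem differentiableOn_res2 (hS : IsOpen S) (hR₀ : 0 < R) (hR : R < ρ)
    (hu : DifferentiableOn ℂ u (S ×ˢ puncturedBall ρ)) : DifferentiableOn ℂ (res2 R u) S := by
  refine DifferentiableOn.const_mul (fun x hx => ?_) _
  refine (hasDerivAt_circleIntegral_param (F := fun x w => u (x, w)) hS hR₀.le
      ?_ ?_ hx).differentiableAt.differentiableWithinAt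
  · exact hu.continuousOn.mono (prod_mono le_rfl (sphere_subset_puncturedBall hR₀ hR))
  · exact fun w hw => hu.comp (f := fun x => (x, w)) (by fun_prop)
      fun x hx => ⟨hx, sphere_subset_puncturedBall hR₀ hR hw⟩

theorem circleIntegral_kernel (hS : IsOpen S) (hr₀ : 0 < r) (hr : r < ρ) {T : Set ℂ}
    (hT : IsOpen T) (hu : DifferentiableOn ℂ u (S ×ˢ puncturedBall ρ)) {k : ℂ → ℂ → ℂ}
    (hkc : ContinuousOn (uncurry k) (T ×ˢ sphere 0 r))
    (hk : ∀ w ∈ sphere (0 : ℂ) r, DifferentiableOn ℂ (fun y => k y w) T) :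
    DifferentiableOn ℂ (fun z : ℂ × ℂ => ∮ w in C(0, r), u (z.1, w) * k z.2 w) (S ×ˢ T) ∧
      ∀ z ∈ S ×ˢ T, HasDerivAt (fun y => ∮ w in C(0, r), u (z.1, w) * k y w)
        (∮ w in C(0, r), u (z.1, w) * deriv (fun y => k y w) z.2) z.2 := by
  have hsub := sphere_subset_puncturedBall hr₀ hr
  constructor
  · refine differentiableOn_circleIntegral_param (hS.prod hT) hr₀.le ?_ fun w hw => ?_
    · refine ContinuousOn.mul ?_ ?_
      · exact hu.continuousOn.comp (f := fun p : (ℂ × ℂ) × ℂ => (p.1.1, p.2)) (by fun_prop)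
          fun p hp => ⟨hp.1.1, hsub hp.2⟩
      · exact hkc.comp (f := fun p : (ℂ × ℂ) × ℂ => (p.1.2, p.2)) (by fun_prop)
          fun p hp => ⟨hp.1.2, hp.2⟩
    · refine DifferentiableOn.mul ?_ ?_
      · exact hu.comp (f := fun z : ℂ × ℂ => (z.1, w)) (by fun_prop) fun z hz => ⟨hz.1, hsub hw⟩
      · exact (hk w hw).comp (f := Prod.snd) (by fun_prop) fun z hz => hz.2
  · rintro ⟨x, y⟩ ⟨hx, hy⟩
    have h := hasDerivAt_circleIntegral_param (c := 0) (F := fun y w => u (x, w) * k y w) hT hr₀.le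
      ?_ ?_ hy
    · convert h using 1
      refine circleIntegral.integral_congr hr₀.le fun w hw => ?_
      exact (deriv_const_mul (u (x, w)) ((hk w hw).differentiableAt (hT.mem_nhds hy))).symm
    · refine ContinuousOn.mul ?_ hkc
      exact hu.continuousOn.comp (f := fun p : ℂ × ℂ => (x, p.2)) (by fun_prop)
        fun p hp => ⟨hx, hsub hp.2⟩
    · exact fun w hw => (hk w hw).const_mul _

theorem circleIntegral_log_outer (hS : IsOpen S) (hR₀ : 0 < R) (hR : R < ρ)
    (hu : DifferentiableOn ℂ u (S ×ˢ puncturedBall ρ)) :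
    DifferentiableOn ℂ
        (fun z : ℂ × ℂ => ∮ w in C(0, R), u (z.1, w) * Complex.log (1 - z.2 / w))
        (S ×ˢ ball 0 R) ∧
      ∀ z ∈ S ×ˢ ball 0 R,
        HasDerivAt (fun y => ∮ w in C(0, R), u (z.1, w) * Complex.log (1 - y / w))
          (-∮ w in C(0, R), u (z.1, w) / (w - z.2)) z.2 := by
  have hslit : ∀ y ∈ ball (0 : ℂ) R, ∀ w ∈ sphere (0 : ℂ) R, 1 - y / w ∈ Complex.slitPlane := by
    intro y hy w hw
    refine one_sub_div_mem_slitPlane ?_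
    rw [mem_sphere_zero_iff_norm.1 hw]
    exact mem_ball_zero_iff.1 hy
  have hw0 : ∀ w ∈ sphere (0 : ℂ) R, w ≠ 0 := fun w hw =>
    (mem_puncturedBall.1 (sphere_subset_puncturedBall hR₀ hR hw)).2
  obtain ⟨h1, h2⟩ := circleIntegral_kernel (k := fun y w => Complex.log (1 - y / w)) hS hR₀ hR
    isOpen_ball hu
    (ContinuousOn.clog (continuousOn_const.sub
      (ContinuousOn.div (by fun_prop) (by fun_prop) fun p hp => hw0 _ hp.2))
      fun p hp => hslit _ hp.1 _ hp.2)
    (fun w hw => DifferentiableOn.clog (by fun_prop) fun y hy => hslit y hy w hw)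
  refine ⟨h1, fun z hz => ?_⟩
  convert h2 z hz using 1
  rw [← neg_one_mul, ← circleIntegral.integral_const_mul]
  refine circleIntegral.integral_congr hR₀.le fun w hw => ?_
  have hd : HasDerivAt (fun y => Complex.log (1 - y / w)) (-(1 / w) / (1 - z.2 / w)) z.2 :=
    (((hasDerivAt_id z.2).div_const w).const_sub 1).clog (hslit _ hz.2 _ hw)
  simp only [hd.deriv]
  have h0 := hw0 w hw
  have h1 : w - z.2 ≠ 0 := by
    intro h
    have := hslit _ hz.2 _ hw
    rw [← sub_eq_zero.1 h, div_self h0, sub_self] at this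
    exact Complex.slitPlane_ne_zero this rfl
  have h2 : 1 - z.2 / w ≠ 0 := Complex.slitPlane_ne_zero (hslit _ hz.2 _ hw)
  have h3 : w - z.2 = w * (1 - z.2 / w) := by field_simp
  rw [h3]
  field_simp

theorem circleIntegral_log_inner (hS : IsOpen S) (hr₀ : 0 < r) (hr : r < ρ)
    (hu : DifferentiableOn ℂ u (S ×ˢ puncturedBall ρ)) :
    DifferentiableOn ℂ
        (fun z : ℂ × ℂ => ∮ w in C(0, r), u (z.1, w) * Complex.log (1 - w / z.2))
        (S ×ˢ {y | r < ‖y‖}) ∧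
      ∀ z ∈ S ×ˢ {y | r < ‖y‖},
        HasDerivAt (fun y => ∮ w in C(0, r), u (z.1, w) * Complex.log (1 - w / y))
          ((∮ w in C(0, r), u (z.1, w) / (z.2 - w)) - (∮ w in C(0, r), u (z.1, w)) / z.2)
          z.2 := by
  have hslit : ∀ y ∈ {y : ℂ | r < ‖y‖}, ∀ w ∈ sphere (0 : ℂ) r,
      1 - w / y ∈ Complex.slitPlane := by
    intro y hy w hw
    refine one_sub_div_mem_slitPlane ?_
    rw [mem_sphere_zero_iff_norm.1 hw]
    exact hy
  have hy0 : ∀ y ∈ {y : ℂ | r < ‖y‖}, y ≠ 0 := fun y hy => norm_pos_iff.1 (hr₀.trans hy)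
  obtain ⟨h1, h2⟩ := circleIntegral_kernel (k := fun y w => Complex.log (1 - w / y)) hS hr₀ hr
    (isOpen_lt continuous_const continuous_norm) hu
    (ContinuousOn.clog (continuousOn_const.sub
      (ContinuousOn.div (by fun_prop) (by fun_prop) fun p hp => hy0 _ hp.1))
      fun p hp => hslit _ hp.1 _ hp.2)
    (fun w hw => DifferentiableOn.clog ((differentiableOn_const _).sub
      (DifferentiableOn.div (by fun_prop) (by fun_prop) hy0)) fun y hy => hslit y hy w hw)
  refine ⟨h1, fun z hz => ?_⟩
  have hne : ∀ w ∈ sphere (0 : ℂ) r, z.2 - w ≠ 0 := by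
    intro w hw h
    have : r < ‖z.2‖ := hz.2
    rw [sub_eq_zero.1 h, mem_sphere_zero_iff_norm.1 hw] at this
    exact this.false
  have huc : ContinuousOn (fun w => u (z.1, w)) (sphere 0 r) :=
    (differentiableOn_slice hu hz.1).continuousOn.mono (sphere_subset_puncturedBall hr₀ hr)
  convert h2 z hz using 1
  rw [div_eq_inv_mul, ← circleIntegral.integral_const_mul, ← circleIntegral.integral_sub]
  · refine circleIntegral.integral_congr hr₀.le fun w hw => ?_
    have h0 := hy0 _ hz.2
    have hd : HasDerivAt (fun y => Complex.log (1 - w / y)) (w / z.2 ^ 2 / (1 - w / z.2)) z.2 := by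
      refine HasDerivAt.clog ?_ (hslit _ hz.2 _ hw)
      have := ((hasDerivAt_inv h0).const_mul w).const_sub 1
      simpa [div_eq_mul_inv] using this
    simp only [hd.deriv]
    have h1 := hne w hw
    have h3 : 1 - w / z.2 = (z.2 - w) / z.2 := by field_simp
    rw [h3]
    field_simp
    ring
  · exact (huc.div (by fun_prop) hne).circleIntegrable hr₀.le
  · exact (continuousOn_const.mul huc).circleIntegrable hr₀.le

/-- The inner integral in `prim2` may locally be taken over a circle of fixed radius. -/
theorem circleIntegral_log_inner_radius (hR : R < ρ)
    (hu : DifferentiableOn ℂ u (S ×ˢ puncturedBall ρ)) {z : ℂ × ℂ} (hz : z ∈ S ×ˢ ball 0 R)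
    (hr₀ : 0 < r) (hr : r < ‖z.2‖) :
    (∮ w in C(0, ‖z.2‖ / 2), u (z.1, w) * Complex.log (1 - w / z.2)) =
      ∮ w in C(0, r), u (z.1, w) * Complex.log (1 - w / z.2) := by
  have hzR : ‖z.2‖ < R := mem_ball_zero_iff.1 hz.2
  have hd : DifferentiableOn ℂ (fun w => u (z.1, w) * Complex.log (1 - w / z.2))
      (puncturedBall ‖z.2‖) := by
    refine DifferentiableOn.mul ((differentiableOn_slice hu hz.1).mono fun w hw => ?_) ?_
    · rw [mem_puncturedBall] at hw ⊢
      exact ⟨hw.1.trans (hzR.trans hR), hw.2⟩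
    · exact DifferentiableOn.clog (by fun_prop)
        fun w hw => one_sub_div_mem_slitPlane (mem_puncturedBall.1 hw).1
  rcases le_total r (‖z.2‖ / 2) with h | h
  · exact circleIntegral_eq_of_puncturedBall hd hr₀ h (by linarith)
  · exact (circleIntegral_eq_of_puncturedBall hd (by linarith) h hr).symm

theorem prim2_spec (hS : IsOpen S) (hR₀ : 0 < R) (hR : R < ρ)
    (hu : DifferentiableOn ℂ u (S ×ˢ puncturedBall ρ)) {z : ℂ × ℂ}
    (hz : z ∈ S ×ˢ puncturedBall R) :
    DifferentiableAt ℂ (prim2 R u) z ∧ pd2 (prim2 R u) z = u z - res2 R u z.1 / z.2 := by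
  obtain ⟨hzR, hz0⟩ := mem_puncturedBall.1 hz.2
  have hz0' : 0 < ‖z.2‖ := norm_pos_iff.2 hz0
  set r := ‖z.2‖ / 2 with hrdef
  have hr₀ : 0 < r := by positivity
  have hrz : r < ‖z.2‖ := by linarith
  have hrR : r < R := hrz.trans hzR
  have hrρ : r < ρ := hrR.trans hR
  obtain ⟨o1, o2⟩ := circleIntegral_log_outer hS hR₀ hR hu
  obtain ⟨i1, i2⟩ := circleIntegral_log_inner hS hr₀ hrρ hu
  have hballo : IsOpen (S ×ˢ ball (0 : ℂ) R) := hS.prod isOpen_ball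
  have hexto : IsOpen (S ×ˢ {y : ℂ | r < ‖y‖}) :=
    hS.prod (isOpen_lt continuous_const continuous_norm)
  have hzb : z ∈ S ×ˢ ball (0 : ℂ) R := ⟨hz.1, mem_ball_zero_iff.2 hzR⟩
  have hze : z ∈ S ×ˢ {y : ℂ | r < ‖y‖} := ⟨hz.1, hrz⟩
  have heq : prim2 R u =ᶠ[𝓝 z] fun z => (2 * Real.pi * Complex.I)⁻¹ *
      ((∮ w in C(0, r), u (z.1, w) * Complex.log (1 - w / z.2)) -
        ∮ w in C(0, R), u (z.1, w) * Complex.log (1 - z.2 / w)) := by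
    filter_upwards [hballo.mem_nhds hzb, hexto.mem_nhds hze] with y hy1 hy2
    rw [prim2, circleIntegral_log_inner_radius hR hu hy1 hr₀ hy2.2]
  refine ⟨?_, ?_⟩
  · refine DifferentiableAt.congr_of_eventuallyEq ?_ heq
    exact ((i1.differentiableAt (hexto.mem_nhds hze)).sub
      (o1.differentiableAt (hballo.mem_nhds hzb))).const_mul _
  · have hcont : Tendsto (fun y => (z.1, y)) (𝓝 z.2) (𝓝 z) :=
      (Continuous.prodMk_right z.1).tendsto z.2
    have hd := (((i2 z hze).sub (o2 z hzb)).const_mul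
      ((2 * Real.pi * Complex.I : ℂ)⁻¹)).congr_of_eventuallyEq (hcont.eventually heq)
    have hcauchy := circleIntegral_sub_circleIntegral_eq (differentiableOn_slice hu hz.1)
      hr₀ hrz hzR hR
    have hrad := circleIntegral_eq_of_puncturedBall (differentiableOn_slice hu hz.1) hr₀ hrR.le hR
    rw [pd2, hd.deriv, res2, hrad]
    have hpi := Complex.two_pi_I_ne_zero
    field_simp
    linear_combination z.2 * hcauchy

end

/-! ### Germs along the complement of the axes -/

/-- The filter of neighbourhoods of the origin along `Aset`. -/
noncomputable def offAxes : Filter (ℂ × ℂ) := 𝓝[Aset] ((0 : ℂ), (0 : ℂ))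

section

variable {f g : ℂ × ℂ → ℂ} {m : ℕ}

theorem puncturedBall_mono {r ρ : ℝ} (h : r ≤ ρ) : puncturedBall r ⊆ puncturedBall ρ := by
  intro z hz
  rw [mem_puncturedBall] at hz ⊢
  exact ⟨hz.1.trans_le h, hz.2⟩

theorem ball_prod_subset {V : Set (ℂ × ℂ)} (hV : IsOpen V) (h0 : ((0 : ℂ), (0 : ℂ)) ∈ V) :
    ∃ ρ > 0, ball (0 : ℂ) ρ ×ˢ ball (0 : ℂ) ρ ⊆ V := by
  obtain ⟨ρ, hρ, h⟩ := Metric.isOpen_iff.1 hV _ h0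
  exact ⟨ρ, hρ, by rwa [ball_prod_same]⟩

theorem eventually_offAxes {P : ℂ × ℂ → Prop} :
    (∀ᶠ z in offAxes, P z) ↔ ∃ ρ > 0, ∀ z ∈ puncturedBall ρ ×ˢ puncturedBall ρ, P z := by
  constructor
  · intro h
    rw [offAxes, eventually_nhdsWithin_iff, _root_.eventually_nhds_iff] at h
    obtain ⟨V, hV, hVo, h0⟩ := h
    obtain ⟨ρ, hρ, hs⟩ := ball_prod_subset hVo h0
    exact ⟨ρ, hρ, fun z hz => hV z (hs ⟨hz.1.1, hz.2.1⟩) ⟨hz.1.2, hz.2.2⟩⟩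
  · rintro ⟨ρ, hρ, h⟩
    rw [offAxes, eventually_nhdsWithin_iff]
    filter_upwards [(isOpen_ball.prod isOpen_ball).mem_nhds
      (mk_mem_prod (mem_ball_self hρ) (mem_ball_self hρ) :
        ((0 : ℂ), (0 : ℂ)) ∈ ball (0 : ℂ) ρ ×ˢ ball (0 : ℂ) ρ)] with z hz hA
    exact h z ⟨⟨hz.1, hA.1⟩, ⟨hz.2, hA.2⟩⟩

theorem eventually_mem_Aset : ∀ᶠ z in offAxes, z ∈ Aset := eventually_mem_nhdsWithin

theorem Filter.Eventually.nhds_offAxes {P : ℂ × ℂ → Prop} (h : ∀ᶠ z in offAxes, P z) :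
    ∀ᶠ z in offAxes, ∀ᶠ y in 𝓝 z, P y := by
  obtain ⟨ρ, hρ, h⟩ := eventually_offAxes.1 h
  exact eventually_offAxes.2 ⟨ρ, hρ, fun z hz => eventually_of_mem
    (((isOpen_puncturedBall _).prod (isOpen_puncturedBall _)).mem_nhds hz) h⟩

theorem mem_Esp_iff : f ∈ Esp ↔
    ∃ ρ > 0, DifferentiableOn ℂ f (puncturedBall ρ ×ˢ puncturedBall ρ) := by
  constructor
  · rintro ⟨V, hV, h0, h⟩
    obtain ⟨ρ, hρ, hs⟩ := ball_prod_subset hV h0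
    exact ⟨ρ, hρ, h.mono fun z hz => ⟨hs ⟨hz.1.1, hz.2.1⟩, hz.1.2, hz.2.2⟩⟩
  · rintro ⟨ρ, hρ, h⟩
    exact ⟨ball 0 ρ ×ˢ ball 0 ρ, isOpen_ball.prod isOpen_ball,
      ⟨mem_ball_self hρ, mem_ball_self hρ⟩,
      h.mono fun z hz => ⟨⟨hz.1.1, hz.2.1⟩, ⟨hz.1.2, hz.2.2⟩⟩⟩

theorem mem_Esp_iff_eventually : f ∈ Esp ↔ ∀ᶠ z in offAxes, DifferentiableAt ℂ f z := by
  rw [mem_Esp_iff, eventually_offAxes]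
  refine exists_congr fun ρ => and_congr_right fun _ => ?_
  have ho : IsOpen (puncturedBall ρ ×ˢ puncturedBall ρ) :=
    (isOpen_puncturedBall _).prod (isOpen_puncturedBall _)
  exact ⟨fun h z hz => h.differentiableAt (ho.mem_nhds hz),
    fun h z hz => (h z hz).differentiableWithinAt⟩

theorem mem_L2set_iff : f ∈ L2set ↔ ∃ ρ > 0, ∃ (N : ℕ) (g : ℂ × ℂ → ℂ),
    DifferentiableOn ℂ g (ball 0 ρ ×ˢ puncturedBall ρ) ∧
      ∀ z ∈ puncturedBall ρ ×ˢ puncturedBall ρ, g z = z.1 ^ N * f z := by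
  constructor
  · rintro ⟨V, hV, h0, N, g, hg, h⟩
    obtain ⟨ρ, hρ, hs⟩ := ball_prod_subset hV h0
    exact ⟨ρ, hρ, N, g, hg.mono fun z hz => ⟨hs ⟨hz.1, hz.2.1⟩, hz.2.2⟩,
      fun z hz => h z ⟨hs ⟨hz.1.1, hz.2.1⟩, hz.1.2, hz.2.2⟩⟩
  · rintro ⟨ρ, hρ, N, g, hg, h⟩
    exact ⟨ball 0 ρ ×ˢ ball 0 ρ, isOpen_ball.prod isOpen_ball,
      ⟨mem_ball_self hρ, mem_ball_self hρ⟩, N, g,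
      hg.mono fun z hz => ⟨hz.1.1, hz.1.2, hz.2⟩,
      fun z hz => h z ⟨⟨hz.1.1, hz.2.1⟩, ⟨hz.1.2, hz.2.2⟩⟩⟩

theorem mem_L2set_iff_eventually : f ∈ L2set ↔ ∃ ρ > 0, ∃ (N : ℕ) (g : ℂ × ℂ → ℂ),
    DifferentiableOn ℂ g (ball 0 ρ ×ˢ puncturedBall ρ) ∧
      ∀ᶠ z in offAxes, g z = z.1 ^ N * f z := by
  rw [mem_L2set_iff]
  constructor
  · rintro ⟨ρ, hρ, N, g, hg, h⟩
    exact ⟨ρ, hρ, N, g, hg, eventually_offAxes.2 ⟨ρ, hρ, h⟩⟩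
  · rintro ⟨ρ, hρ, N, g, hg, h⟩
    obtain ⟨r, hr, h⟩ := eventually_offAxes.1 h
    refine ⟨min ρ r, lt_min hρ hr, N, g, hg.mono ?_, fun z hz => h z ?_⟩
    · exact prod_mono (ball_subset_ball (min_le_left _ _)) (puncturedBall_mono (min_le_left _ _))
    · exact prod_mono (puncturedBall_mono (min_le_right _ _))
        (puncturedBall_mono (min_le_right _ _)) hz

theorem mem_Esp_congr (hf : f ∈ Esp) (h : f =ᶠ[offAxes] g) : g ∈ Esp := by
  rw [mem_Esp_iff_eventually] at hf ⊢
  filter_upwards [hf, Filter.Eventually.nhds_offAxes h] with z hz hfg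
  exact hz.congr_of_eventuallyEq (EventuallyEq.symm hfg)

theorem mem_L2set_congr (hf : f ∈ L2set) (h : f =ᶠ[offAxes] g) : g ∈ L2set := by
  rw [mem_L2set_iff_eventually] at hf ⊢
  obtain ⟨ρ, hρ, N, k, hk, hkf⟩ := hf
  refine ⟨ρ, hρ, N, k, hk, ?_⟩
  filter_upwards [hkf, h] with z h1 h2
  rw [h1, h2]

theorem L2set_subset_Esp : L2set ⊆ Esp := by
  intro f hf
  obtain ⟨ρ, hρ, N, g, hg, h⟩ := mem_L2set_iff.1 hf
  have hE : (fun z : ℂ × ℂ => (z.1 ^ N)⁻¹ * g z) ∈ Esp := by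
    refine mem_Esp_iff.2 ⟨ρ, hρ, DifferentiableOn.mul ?_ (hg.mono ?_)⟩
    · exact DifferentiableOn.inv (by fun_prop) fun z hz => pow_ne_zero _ hz.1.2
    · exact prod_mono sdiff_subset le_rfl
  refine mem_Esp_congr hE (eventually_offAxes.2 ⟨ρ, hρ, fun z hz => ?_⟩)
  simp only [h z hz]
  exact inv_mul_cancel_left₀ (pow_ne_zero _ hz.1.2) _

/-- `Esp` as a submodule. -/
def espSubmodule : Submodule ℂ (ℂ × ℂ → ℂ) where
  carrier := Esp
  zero_mem' := mem_Esp_iff.2 ⟨1, one_pos, differentiableOn_const _⟩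
  add_mem' := by
    intro f g hf hg
    rw [mem_Esp_iff_eventually] at hf hg ⊢
    filter_upwards [hf, hg] with z h1 h2 using h1.add h2
  smul_mem' := by
    intro c f hf
    rw [mem_Esp_iff_eventually] at hf ⊢
    filter_upwards [hf] with z h1 using h1.const_smul c

/-- `L2set` as a submodule. -/
def l2Submodule : Submodule ℂ (ℂ × ℂ → ℂ) where
  carrier := L2set
  zero_mem' := mem_L2set_iff.2 ⟨1, one_pos, 0, 0, differentiableOn_const _, by simp⟩
  add_mem' := by
    intro f g hf hg
    rw [mem_L2set_iff_eventually] at hf hg ⊢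
    obtain ⟨ρ, hρ, N, k, hk, hkf⟩ := hf
    obtain ⟨ρ', hρ', N', k', hk', hkf'⟩ := hg
    refine ⟨min ρ ρ', lt_min hρ hρ', N + N', fun z => z.1 ^ N' * k z + z.1 ^ N * k' z, ?_, ?_⟩
    · refine DifferentiableOn.add (DifferentiableOn.mul (by fun_prop) (hk.mono ?_))
        (DifferentiableOn.mul (by fun_prop) (hk'.mono ?_))
      · exact prod_mono (ball_subset_ball (min_le_left _ _)) (puncturedBall_mono (min_le_left _ _))
      · exact prod_mono (ball_subset_ball (min_le_right _ _))
          (puncturedBall_mono (min_le_right _ _))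
    · filter_upwards [hkf, hkf'] with z h1 h2
      rw [h1, h2, Pi.add_apply]
      ring
  smul_mem' := by
    intro c f hf
    rw [mem_L2set_iff_eventually] at hf ⊢
    obtain ⟨ρ, hρ, N, k, hk, hkf⟩ := hf
    refine ⟨ρ, hρ, N, fun z => c * k z, hk.const_mul c, ?_⟩
    filter_upwards [hkf] with z h1
    rw [h1, Pi.smul_apply, smul_eq_mul]
    ring

theorem mem_L2set_of_eventuallyEq_zero (h : ∀ᶠ z in offAxes, f z = 0) : f ∈ L2set :=
  mem_L2set_congr l2Submodule.zero_mem (h.mono fun _ hz => hz.symm)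

/-! ### The operators on germs -/

theorem pd1_congr (h : f =ᶠ[offAxes] g) : pd1 f =ᶠ[offAxes] pd1 g := by
  filter_upwards [Filter.Eventually.nhds_offAxes h] with z hz
  have hc : Tendsto (fun w => (w, z.2)) (𝓝 z.1) (𝓝 z) :=
    (Continuous.prodMk_left z.2).tendsto z.1
  exact EventuallyEq.deriv_eq (hc.eventually hz)

theorem pd2_congr (h : f =ᶠ[offAxes] g) : pd2 f =ᶠ[offAxes] pd2 g := by
  filter_upwards [Filter.Eventually.nhds_offAxes h] with z hz
  have hc : Tendsto (fun w => (z.1, w)) (𝓝 z.2) (𝓝 z) :=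
    (Continuous.prodMk_right z.1).tendsto z.2
  exact EventuallyEq.deriv_eq (hc.eventually hz)

theorem pd1_add (hf : f ∈ Esp) (hg : g ∈ Esp) : pd1 (f + g) =ᶠ[offAxes] pd1 f + pd1 g := by
  filter_upwards [mem_Esp_iff_eventually.1 hf, mem_Esp_iff_eventually.1 hg] with z h1 h2
  exact ((hasDerivAt_pd1 h1).add (hasDerivAt_pd1 h2)).deriv

theorem pd2_add (hf : f ∈ Esp) (hg : g ∈ Esp) : pd2 (f + g) =ᶠ[offAxes] pd2 f + pd2 g := by
  filter_upwards [mem_Esp_iff_eventually.1 hf, mem_Esp_iff_eventually.1 hg] with z h1 h2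
  exact ((hasDerivAt_pd2 h1).add (hasDerivAt_pd2 h2)).deriv

theorem pd1_smul (c : ℂ) (hf : f ∈ Esp) : pd1 (c • f) =ᶠ[offAxes] c • pd1 f := by
  filter_upwards [mem_Esp_iff_eventually.1 hf] with z h1
  exact ((hasDerivAt_pd1 h1).const_smul c).deriv

theorem pd2_smul (c : ℂ) (hf : f ∈ Esp) : pd2 (c • f) =ᶠ[offAxes] c • pd2 f := by
  filter_upwards [mem_Esp_iff_eventually.1 hf] with z h1
  exact ((hasDerivAt_pd2 h1).const_smul c).deriv

theorem φ1_add (hf : f ∈ Esp) (hg : g ∈ Esp) :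
    φ1 m (f + g) =ᶠ[offAxes] φ1 m f + φ1 m g := by
  filter_upwards [pd1_add hf hg] with z h
  simp only [φ1, h, Pi.add_apply]
  ring

theorem φ1_smul (c : ℂ) (hf : f ∈ Esp) : φ1 m (c • f) =ᶠ[offAxes] c • φ1 m f := by
  filter_upwards [pd1_smul c hf] with z h
  simp only [φ1, h, Pi.smul_apply, smul_eq_mul]
  ring

theorem φ1_congr (h : f =ᶠ[offAxes] g) : φ1 m f =ᶠ[offAxes] φ1 m g := by
  filter_upwards [pd1_congr h, h] with z h1 h2
  simp only [φ1, h1, h2]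

theorem ψop_eq (f g : ℂ × ℂ → ℂ) : ψop m f g = φ1 m g - φ2 f := rfl

theorem φ2_eq (f : ℂ × ℂ → ℂ) : φ2 f = pd2 f := rfl

theorem pd1_mem_Esp (hf : f ∈ Esp) : pd1 f ∈ Esp := by
  obtain ⟨ρ, hρ, h⟩ := mem_Esp_iff.1 hf
  exact mem_Esp_iff.2 ⟨ρ, hρ,
    differentiableOn_pd1 ((isOpen_puncturedBall _).prod (isOpen_puncturedBall _)) h⟩

theorem pd2_mem_Esp (hf : f ∈ Esp) : pd2 f ∈ Esp := by
  obtain ⟨ρ, hρ, h⟩ := mem_Esp_iff.1 hf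
  exact mem_Esp_iff.2 ⟨ρ, hρ,
    differentiableOn_pd2 ((isOpen_puncturedBall _).prod (isOpen_puncturedBall _)) h⟩

theorem φ1_mem_Esp (hf : f ∈ Esp) : φ1 m f ∈ Esp := by
  refine espSubmodule.sub_mem (x := pd1 f)
    (y := fun z => (m : ℂ) * z.1 ^ (-(m : ℤ) - 1) * f z) (pd1_mem_Esp hf) ?_
  refine mem_Esp_iff_eventually.2 ?_
  filter_upwards [mem_Esp_iff_eventually.1 hf, eventually_mem_Aset] with z h1 h2
  exact ((differentiableAt_fst.zpow (Or.inl h2.1)).const_mul _).mul h1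

theorem pd1_mem_L2set (hf : f ∈ L2set) : pd1 f ∈ L2set := by
  have hE := L2set_subset_Esp hf
  obtain ⟨ρ, hρ, N, g, hg, h⟩ := mem_L2set_iff_eventually.1 hf
  have ho : IsOpen (ball (0 : ℂ) ρ ×ˢ puncturedBall ρ) := isOpen_ball.prod (isOpen_puncturedBall _)
  refine mem_L2set_iff_eventually.2 ⟨ρ, hρ, N + 1, fun z => z.1 * pd1 g z - N * g z, ?_, ?_⟩
  · exact ((differentiableOn_fst).mul (differentiableOn_pd1 ho hg)).sub (hg.const_mul _)
  · filter_upwards [h, pd1_congr h, mem_Esp_iff_eventually.1 hE] with z h1 h2 h3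
    rw [h1, h2]
    have hd : HasDerivAt (fun w => w ^ N * f (w, z.2))
        (N * z.1 ^ (N - 1) * f z + z.1 ^ N * pd1 f z) z.1 :=
      (hasDerivAt_pow N z.1).mul (hasDerivAt_pd1 h3)
    rw [pd1, hd.deriv]
    rcases N with _ | N
    · simp
    · push_cast
      ring

theorem pd2_mem_L2set (hf : f ∈ L2set) : pd2 f ∈ L2set := by
  have hE := L2set_subset_Esp hf
  obtain ⟨ρ, hρ, N, g, hg, h⟩ := mem_L2set_iff_eventually.1 hf
  have ho : IsOpen (ball (0 : ℂ) ρ ×ˢ puncturedBall ρ) := isOpen_ball.prod (isOpen_puncturedBall _)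
  refine mem_L2set_iff_eventually.2 ⟨ρ, hρ, N, pd2 g, differentiableOn_pd2 ho hg, ?_⟩
  filter_upwards [pd2_congr h, mem_Esp_iff_eventually.1 hE] with z h2 h3
  rw [h2]
  exact ((hasDerivAt_pd2 h3).const_mul (z.1 ^ N)).deriv

theorem φ1_mem_L2set (hf : f ∈ L2set) : φ1 m f ∈ L2set := by
  refine l2Submodule.sub_mem (x := pd1 f)
    (y := fun z => (m : ℂ) * z.1 ^ (-(m : ℤ) - 1) * f z) (pd1_mem_L2set hf) ?_
  obtain ⟨ρ, hρ, N, g, hg, h⟩ := mem_L2set_iff_eventually.1 hf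
  refine mem_L2set_iff_eventually.2 ⟨ρ, hρ, N + m + 1, fun z => m * g z, hg.const_mul _, ?_⟩
  filter_upwards [h, eventually_mem_Aset] with z h1 h2
  have hz : z.1 ^ (-(m : ℤ) - 1) * z.1 ^ (m + 1) = 1 := by
    rw [← zpow_natCast, ← zpow_add₀ h2.1]
    simp
  rw [h1]
  linear_combination (-(m * z.1 ^ N * f z)) * hz

theorem ψop_mem_L2set (hf : f ∈ L2set) (hg : g ∈ L2set) : ψop m f g ∈ L2set :=
  l2Submodule.sub_mem (φ1_mem_L2set hg) (pd2_mem_L2set hf)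

theorem pd2_φ1 (hf : f ∈ Esp) : pd2 (φ1 m f) =ᶠ[offAxes] φ1 m (pd2 f) := by
  obtain ⟨ρ, hρ, h⟩ := mem_Esp_iff.1 hf
  have ho : IsOpen (puncturedBall ρ ×ˢ puncturedBall ρ) :=
    (isOpen_puncturedBall _).prod (isOpen_puncturedBall _)
  refine eventually_offAxes.2 ⟨ρ, hρ, fun z hz => ?_⟩
  have h1 := hasDerivAt_pd2 ((differentiableOn_pd1 ho h).differentiableAt (ho.mem_nhds hz))
  have h2 := hasDerivAt_pd2 (h.differentiableAt (ho.mem_nhds hz))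
  rw [φ1, pd1_pd2_comm ho h hz]
  exact (h1.sub (h2.const_mul ((m : ℂ) * z.1 ^ (-(m : ℤ) - 1)))).deriv

theorem ψop_φ (hf : f ∈ Esp) : ψop m (φ1 m f) (φ2 f) ∈ L2set := by
  refine mem_L2set_of_eventuallyEq_zero ?_
  filter_upwards [pd2_φ1 (m := m) hf] with z hz
  rw [ψop_eq, Pi.sub_apply, φ2_eq, φ2_eq, hz, sub_self]

end

/-! ### Functions of the first variable -/

/-- The function `b` is holomorphic on a punctured neighbourhood of the origin. -/
def PuncturedHol (b : ℂ → ℂ) : Prop := ∃ ρ > 0, DifferentiableOn ℂ b (puncturedBall ρ)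

section

variable {b c : ℂ → ℂ} {u v : ℂ × ℂ → ℂ} {m : ℕ} {R ρ : ℝ}

theorem isPreconnected_puncturedBall (hρ : 0 < ρ) : IsPreconnected (puncturedBall ρ) := by
  have h : puncturedBall ρ = Complex.exp '' {z | z.re < Real.log ρ} := by
    ext z
    rw [mem_puncturedBall, mem_image]
    constructor
    · rintro ⟨h1, h2⟩
      refine ⟨Complex.log z, ?_, Complex.exp_log h2⟩
      change (Complex.log z).re < _
      rw [Complex.log_re]
      exact Real.log_lt_log (norm_pos_iff.2 h2) h1
    · rintro ⟨w, hw, rfl⟩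
      refine ⟨?_, Complex.exp_ne_zero w⟩
      rw [Complex.norm_exp]
      exact (Real.lt_log_iff_exp_lt hρ).1 hw
  rw [h]
  exact (convex_halfSpace_re_lt _).isPreconnected.image _ Complex.continuous_exp.continuousOn

theorem eventually_punctured {P : ℂ → Prop} :
    (∀ᶠ z in 𝓝[≠] (0 : ℂ), P z) ↔ ∃ ρ > 0, ∀ z ∈ puncturedBall ρ, P z := by
  rw [(nhdsWithin_hasBasis nhds_basis_ball _).eventually_iff]
  exact Iff.rfl

theorem eventually_offAxes_fst {P : ℂ → Prop} (h : ∀ᶠ x in 𝓝[≠] (0 : ℂ), P x) :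
    ∀ᶠ z in offAxes, P z.1 := by
  obtain ⟨ρ, hρ, h⟩ := eventually_punctured.1 h
  exact eventually_offAxes.2 ⟨ρ, hρ, fun z hz => h z.1 hz.1⟩

theorem puncturedHol_iff_eventually :
    PuncturedHol b ↔ ∀ᶠ z in 𝓝[≠] (0 : ℂ), DifferentiableAt ℂ b z := by
  rw [eventually_punctured]
  exact exists_congr fun ρ => and_congr_right fun _ =>
    ⟨fun h z hz => h.differentiableAt ((isOpen_puncturedBall ρ).mem_nhds hz),
      fun h z hz => (h z hz).differentiableWithinAt⟩

theorem PuncturedHol.mem_Esp (hb : PuncturedHol b) : (fun z : ℂ × ℂ => b z.1) ∈ Esp := by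
  refine mem_Esp_iff_eventually.2 ?_
  filter_upwards [eventually_offAxes_fst (puncturedHol_iff_eventually.1 hb)] with z hz
  exact hz.comp z differentiableAt_fst

theorem PuncturedHol.div_mem_Esp (hb : PuncturedHol b) :
    (fun z : ℂ × ℂ => b z.1 / z.2) ∈ Esp := by
  refine mem_Esp_iff_eventually.2 ?_
  filter_upwards [mem_Esp_iff_eventually.1 hb.mem_Esp, eventually_mem_Aset] with z hz hA
  simp_rw [div_eq_mul_inv]
  exact hz.mul (differentiableAt_snd.inv hA.2)

theorem exists_analytic_of_meromorphicAt (hb : MeromorphicAt b 0) :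
    ∃ ρ > 0, ∃ N : ℕ, DifferentiableOn ℂ (fun x => x ^ N * b x) (ball 0 ρ) := by
  obtain ⟨N, hN⟩ := hb
  obtain ⟨ρ, hρ, h⟩ := Metric.eventually_nhds_iff_ball.1 hN.eventually_analyticAt
  refine ⟨ρ, hρ, N, fun x hx => ?_⟩
  simpa using (h x hx).differentiableAt.differentiableWithinAt

theorem meromorphicAt_of_analytic {N : ℕ} {g : ℂ → ℂ} (hρ : 0 < ρ)
    (hg : DifferentiableOn ℂ g (ball 0 ρ)) (h : ∀ x ∈ puncturedBall ρ, g x = x ^ N * b x) :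
    MeromorphicAt b 0 := by
  have h1 : MeromorphicAt g 0 := (hg.analyticAt (ball_mem_nhds 0 hρ)).meromorphicAt
  have h2 : MeromorphicAt (fun x : ℂ => (x ^ N)⁻¹ * g x) 0 :=
    (((MeromorphicAt.id (0 : ℂ)).pow N).inv).mul h1
  refine h2.congr (eventually_punctured.2 ⟨ρ, hρ, fun x hx => ?_⟩)
  simp only [h x hx]
  exact inv_mul_cancel_left₀ (pow_ne_zero _ (mem_puncturedBall.1 hx).2) _

theorem MeromorphicAt.mul_mem_L2set (hb : MeromorphicAt b 0) {k : ℂ → ℂ}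
    (hk : PuncturedHol k) : (fun z : ℂ × ℂ => b z.1 * k z.2) ∈ L2set := by
  obtain ⟨ρ, hρ, N, h⟩ := exists_analytic_of_meromorphicAt hb
  obtain ⟨r, hr, hk⟩ := hk
  refine mem_L2set_iff.2 ⟨min ρ r, lt_min hρ hr, N, fun z => z.1 ^ N * b z.1 * k z.2, ?_,
    fun z _ => mul_assoc _ _ _⟩
  refine DifferentiableOn.mul
    (h.comp (t := ball 0 ρ) (f := Prod.fst) differentiableOn_fst fun z hz => ?_)
    (hk.comp (t := puncturedBall r) (f := Prod.snd) differentiableOn_snd fun z hz => ?_)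
  · exact ball_subset_ball (min_le_left _ _) hz.1
  · exact puncturedBall_mono (min_le_right _ _) hz.2

theorem MeromorphicAt.mem_L2set (hb : MeromorphicAt b 0) :
    (fun z : ℂ × ℂ => b z.1) ∈ L2set := by
  simpa using hb.mul_mem_L2set (k := fun _ => 1) ⟨1, one_pos, differentiableOn_const _⟩

theorem MeromorphicAt.div_mem_L2set (hb : MeromorphicAt b 0) :
    (fun z : ℂ × ℂ => b z.1 / z.2) ∈ L2set := by
  simpa [div_eq_mul_inv] using hb.mul_mem_L2set (k := fun y => y⁻¹)
    ⟨1, one_pos, fun x hx => (differentiableAt_inv hx.2).differentiableWithinAt⟩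

/-! ### Decomposition with respect to `∂₂` -/

theorem exists_pd2_add_div (hu : u ∈ Esp) : ∃ v ∈ Esp, ∃ c, PuncturedHol c ∧
    u =ᶠ[offAxes] fun z => pd2 v z + c z.1 / z.2 := by
  obtain ⟨ρ, hρ, h⟩ := mem_Esp_iff.1 hu
  have hR : ρ / 2 < ρ := by linarith
  have hR₀ : 0 < ρ / 2 := by linarith
  have hS := isOpen_puncturedBall ρ
  have hsub : puncturedBall (ρ / 2) ×ˢ puncturedBall (ρ / 2) ⊆
      puncturedBall ρ ×ˢ puncturedBall (ρ / 2) := prod_mono (puncturedBall_mono hR.le) le_rfl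
  refine ⟨prim2 (ρ / 2) u, mem_Esp_iff.2 ⟨ρ / 2, hR₀, fun z hz => ?_⟩, res2 (ρ / 2) u,
    ⟨ρ, hρ, differentiableOn_res2 hS hR₀ hR h⟩,
    eventually_offAxes.2 ⟨ρ / 2, hR₀, fun z hz => ?_⟩⟩
  · exact (prim2_spec hS hR₀ hR h (hsub hz)).1.differentiableWithinAt
  · simp only [(prim2_spec hS hR₀ hR h (hsub hz)).2, sub_add_cancel]

theorem exists_pd2_add_div_of_mem_L2set (hu : u ∈ L2set) : ∃ v ∈ L2set, ∃ c, MeromorphicAt c 0 ∧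
    u =ᶠ[offAxes] fun z => pd2 v z + c z.1 / z.2 := by
  obtain ⟨ρ, hρ, N, g, hg, h⟩ := mem_L2set_iff.1 hu
  have hR : ρ / 2 < ρ := by linarith
  have hR₀ : 0 < ρ / 2 := by linarith
  have hS : IsOpen (ball (0 : ℂ) ρ) := isOpen_ball
  refine ⟨fun z => (z.1 ^ N)⁻¹ * prim2 (ρ / 2) g z, mem_L2set_iff.2 ⟨ρ / 2, hR₀, N,
    prim2 (ρ / 2) g, fun z hz => ?_, fun z hz => ?_⟩,
    fun x => (x ^ N)⁻¹ * res2 (ρ / 2) g x, ?_,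
    eventually_offAxes.2 ⟨ρ / 2, hR₀, fun z hz => ?_⟩⟩
  · exact (prim2_spec hS hR₀ hR hg
      ⟨ball_subset_ball hR.le hz.1, hz.2⟩).1.differentiableWithinAt
  · exact (mul_inv_cancel_left₀ (pow_ne_zero _ hz.1.2) _).symm
  · refine meromorphicAt_of_analytic (N := N) hρ (differentiableOn_res2 hS hR₀ hR hg)
      fun x hx => (mul_inv_cancel_left₀ (pow_ne_zero _ hx.2) _).symm
  · have hz' : z ∈ ball (0 : ℂ) ρ ×ˢ puncturedBall (ρ / 2) :=
      ⟨ball_subset_ball hR.le hz.1.1, hz.2⟩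
    obtain ⟨h1, h2⟩ := prim2_spec hS hR₀ hR hg hz'
    have h3 : pd2 (fun z => (z.1 ^ N)⁻¹ * prim2 (ρ / 2) g z) z =
        (z.1 ^ N)⁻¹ * pd2 (prim2 (ρ / 2) g) z :=
      ((hasDerivAt_pd2 h1).const_mul ((z.1 ^ N)⁻¹)).deriv
    have h4 := h z ⟨puncturedBall_mono hR.le hz.1, puncturedBall_mono hR.le hz.2⟩
    have h5 : z.1 ^ N ≠ 0 := pow_ne_zero _ hz.1.2
    simp only [h3, h2, h4]
    field_simp
    ring

theorem res2_pd2_add_div {w : ℂ × ℂ → ℂ} {x y : ℂ} (hR₀ : 0 < R) (hR : R < ρ)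
    (hw : DifferentiableOn ℂ w (puncturedBall ρ ×ˢ puncturedBall ρ)) (hx : x ∈ puncturedBall ρ)
    (hu : ∀ s ∈ sphere (0 : ℂ) R, u (x, s) = pd2 w (x, s) + y / s) : res2 R u x = y := by
  have ho : IsOpen (puncturedBall ρ ×ˢ puncturedBall ρ) :=
    (isOpen_puncturedBall _).prod (isOpen_puncturedBall _)
  have hsph := sphere_subset_puncturedBall hR₀ hR
  have h1 : ∮ s in C(0, R), pd2 w (x, s) = 0 := by
    refine circleIntegral.integral_eq_zero_of_hasDerivWithinAt (f := fun s => w (x, s)) hR₀.le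
      fun s hs => ?_
    exact (hasDerivAt_pd2 (z := (x, s))
      (hw.differentiableAt (ho.mem_nhds ⟨hx, hsph hs⟩))).hasDerivWithinAt
  have h2 : ∮ s in C(0, R), y / s = y * (2 * Real.pi * Complex.I) := by
    simp_rw [div_eq_mul_inv, circleIntegral.integral_const_mul]
    rw [← circleIntegral.integral_sub_center_inv 0 hR₀.ne']
    simp
  have h3 : ContinuousOn (fun s => pd2 w (x, s)) (sphere 0 R) :=
    (differentiableOn_slice (differentiableOn_pd2 ho hw) hx).continuousOn.mono hsph
  have h4 : ContinuousOn (fun s : ℂ => y / s) (sphere 0 R) :=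
    continuousOn_const.div continuousOn_id fun s hs => (hsph hs).2
  rw [res2, circleIntegral.integral_congr hR₀.le hu,
    circleIntegral.integral_add (h3.circleIntegrable hR₀.le) (h4.circleIntegrable hR₀.le), h1, h2]
  have := Complex.two_pi_I_ne_zero
  field_simp
  ring

/-- The residue in the second variable of an element of `L2set` is meromorphic. -/
theorem meromorphicAt_of_pd2_add_div_mem {w : ℂ × ℂ → ℂ} (hw : w ∈ Esp)
    (h : (fun z => pd2 w z + b z.1 / z.2) ∈ L2set) : MeromorphicAt b 0 := by
  obtain ⟨ρ₁, hρ₁, hw⟩ := mem_Esp_iff.1 hw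
  obtain ⟨ρ₂, hρ₂, N, g, hg, h⟩ := mem_L2set_iff.1 h
  obtain ⟨ρ, hρ, h1, h2⟩ : ∃ ρ > 0, ρ ≤ ρ₁ ∧ ρ ≤ ρ₂ :=
    ⟨min ρ₁ ρ₂, lt_min hρ₁ hρ₂, min_le_left _ _, min_le_right _ _⟩
  have hR : ρ / 2 < ρ := by linarith
  have hR₀ : 0 < ρ / 2 := by linarith
  have hg' := hg.mono (prod_mono (ball_subset_ball h2) (puncturedBall_mono h2))
  have hw' := hw.mono (prod_mono (puncturedBall_mono h1) (puncturedBall_mono h1))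
  refine meromorphicAt_of_analytic (N := N) hρ
    (differentiableOn_res2 isOpen_ball hR₀ hR hg') fun x hx => ?_
  refine (res2_pd2_add_div (w := fun z => x ^ N * w z) hR₀ hR (hw'.const_mul _) hx ?_)
  intro s hs
  have hs' := sphere_subset_puncturedBall hR₀ hR hs
  rw [h (x, s) ⟨puncturedBall_mono h2 hx, puncturedBall_mono h2 hs'⟩]
  have h3 : pd2 (fun z => x ^ N * w z) (x, s) = x ^ N * pd2 w (x, s) :=
    ((hasDerivAt_pd2 (z := (x, s)) (hw'.differentiableAt
      (((isOpen_puncturedBall _).prod (isOpen_puncturedBall _)).mem_nhds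
        ⟨hx, hs'⟩))).const_mul (x ^ N)).deriv
  rw [h3]
  ring

theorem exists_sub_fst_mem_L2set (hu : u ∈ Esp) (h : pd2 u ∈ L2set) :
    ∃ b, PuncturedHol b ∧ u - (fun z => b z.1) ∈ L2set := by
  obtain ⟨v, hv, c, -, hc⟩ := exists_pd2_add_div_of_mem_L2set h
  have hvE := L2set_subset_Esp hv
  have hE : u - v ∈ Esp := espSubmodule.sub_mem hu hvE
  obtain ⟨ρ₁, hρ₁, hd⟩ := mem_Esp_iff.1 hE
  have hc' : ∀ᶠ z in offAxes, pd2 (u - v) z = c z.1 / z.2 := by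
    filter_upwards [hc, mem_Esp_iff_eventually.1 hu, mem_Esp_iff_eventually.1 hvE] with z h1 h2 h3
    have : pd2 (u - v) z = pd2 u z - pd2 v z :=
      ((hasDerivAt_pd2 h2).sub (hasDerivAt_pd2 h3)).deriv
    rw [this, h1]
    ring
  obtain ⟨ρ₂, hρ₂, hc'⟩ := eventually_offAxes.1 hc'
  obtain ⟨ρ, hρ, h1, h2⟩ : ∃ ρ > 0, ρ ≤ ρ₁ ∧ ρ ≤ ρ₂ :=
    ⟨min ρ₁ ρ₂, lt_min hρ₁ hρ₂, min_le_left _ _, min_le_right _ _⟩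
  have hR : ρ / 2 < ρ := by linarith
  have hR₀ : 0 < ρ / 2 := by linarith
  have ho : IsOpen (puncturedBall ρ ×ˢ puncturedBall ρ) :=
    (isOpen_puncturedBall _).prod (isOpen_puncturedBall _)
  have hd' := hd.mono (prod_mono (puncturedBall_mono h1) (puncturedBall_mono h1))
  have hc₀ : ∀ x ∈ puncturedBall ρ, c x = 0 := by
    intro x hx
    have e1 := res2_pd2_add_div (u := fun _ => 0) (y := -c x) hR₀ hR hd' hx fun s hs => by
      have hs' := sphere_subset_puncturedBall hR₀ hR hs
      rw [hc' (x, s) ⟨puncturedBall_mono h2 hx, puncturedBall_mono h2 hs'⟩]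
      ring
    rw [← neg_eq_zero, ← e1]
    simp [res2, circleIntegral]
  have hmem : ((ρ / 2 : ℝ) : ℂ) ∈ puncturedBall ρ := by
    rw [mem_puncturedBall]
    refine ⟨?_, by exact_mod_cast hR₀.ne'⟩
    rw [Complex.norm_real, Real.norm_of_nonneg hR₀.le]
    exact hR
  refine ⟨fun x => (u - v) (x, ((ρ / 2 : ℝ) : ℂ)), ⟨ρ, hρ, ?_⟩, mem_L2set_congr hv ?_⟩
  · exact hd'.comp (f := fun x => (x, ((ρ / 2 : ℝ) : ℂ))) (by fun_prop)
      fun x hx => ⟨hx, hmem⟩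
  · refine eventually_offAxes.2 ⟨ρ, hρ, fun z hz => ?_⟩
    have hcst : (u - v) (z.1, z.2) = (u - v) (z.1, ((ρ / 2 : ℝ) : ℂ)) := by
      refine (isOpen_puncturedBall ρ).is_const_of_deriv_eq_zero
        (f := fun y => (u - v) (z.1, y)) (isPreconnected_puncturedBall hρ)
        (differentiableOn_slice hd' hz.1) (fun y hy => ?_) hz.2 hmem
      have := hc' (z.1, y) ⟨puncturedBall_mono h2 hz.1, puncturedBall_mono h2 hy⟩
      rw [hc₀ z.1 hz.1, zero_div] at this
      exact this
    simp only [Pi.sub_apply] at hcst ⊢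
    rw [← hcst]
    ring

end

/-! ### The operator in one variable -/

/-- The operator `d/dz - m z^{-m-1}` on functions of one variable. -/
noncomputable def Pop (m : ℕ) (b : ℂ → ℂ) (z : ℂ) : ℂ :=
  deriv b z - (m : ℂ) * z ^ (-(m : ℤ) - 1) * b z

section

variable {b c u : ℂ → ℂ} {m : ℕ} {R ρ : ℝ}

theorem φ1_fst (b : ℂ → ℂ) : φ1 m (fun z => b z.1) = fun z => Pop m b z.1 := rfl

theorem φ1_fst_div (b : ℂ → ℂ) :
    φ1 m (fun z => b z.1 / z.2) = fun z => Pop m b z.1 / z.2 := by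
  funext z
  simp only [φ1, Pop, pd1, deriv_div_const]
  ring

theorem differentiableOn_Pop (hb : DifferentiableOn ℂ b (puncturedBall ρ)) :
    DifferentiableOn ℂ (Pop m b) (puncturedBall ρ) := by
  refine (hb.deriv (isOpen_puncturedBall ρ)).sub (DifferentiableOn.mul ?_ hb)
  exact DifferentiableOn.const_mul
    (fun z hz => ((differentiableAt_zpow (𝕜 := ℂ)).2 (Or.inl hz.2)).differentiableWithinAt) _

theorem not_exists_extension_exp (hm : 0 < m) (hR : 0 < R) :
    ¬∃ g : ℂ → ℂ, DifferentiableOn ℂ g (ball 0 R) ∧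
      ∀ z ∈ puncturedBall R, g z = Complex.exp ((z ^ m)⁻¹) := by
  rintro ⟨g, hg, h⟩
  have h1 : Tendsto (fun t : ℝ => g t) (𝓝[>] 0) (𝓝 (g 0)) := by
    have hc : ContinuousAt g ((0 : ℝ) : ℂ) := by
      rw [Complex.ofReal_zero]
      exact (hg.differentiableAt (ball_mem_nhds 0 hR)).continuousAt
    have := hc.tendsto.comp Complex.continuous_ofReal.continuousAt.tendsto
    rw [Complex.ofReal_zero] at this
    exact this.mono_left nhdsWithin_le_nhds
  have h2 : Tendsto (fun t : ℝ => Real.exp ((t ^ m)⁻¹)) (𝓝[>] 0) atTop := by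
    refine Real.tendsto_exp_atTop.comp (tendsto_inv_nhdsGT_zero.comp ?_)
    refine tendsto_nhdsWithin_iff.2 ⟨?_, ?_⟩
    · have : Tendsto (fun t : ℝ => t ^ m) (𝓝 0) (𝓝 (0 ^ m)) := (continuous_pow m).tendsto 0
      rw [zero_pow hm.ne'] at this
      exact this.mono_left nhdsWithin_le_nhds
    · filter_upwards [self_mem_nhdsWithin] with t ht
      exact pow_pos (mem_Ioi.1 ht) m
  refine not_tendsto_nhds_of_tendsto_atTop h2 ‖g 0‖ (h1.norm.congr' ?_)
  filter_upwards [Ioo_mem_nhdsGT hR] with t ht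
  rw [h t]
  · rw [Complex.norm_exp]
    congr 1
    norm_cast
  · rw [mem_puncturedBall, Complex.norm_real, Real.norm_of_nonneg ht.1.le]
    exact ⟨ht.2, by exact_mod_cast ht.1.ne'⟩

theorem hasDerivAt_inv_pow {z : ℂ} (hz : z ≠ 0) :
    HasDerivAt (fun z : ℂ => (z ^ m)⁻¹) (-((m : ℂ) * z ^ (-(m : ℤ) - 1))) z := by
  have h := hasDerivAt_zpow (-(m : ℤ)) z (Or.inl hz)
  simpa [zpow_neg] using h

theorem exists_Pop_eq_of_circleIntegral_eq_zero (hR₀ : 0 < R) (hR : R < ρ)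
    (hc : DifferentiableOn ℂ c (puncturedBall ρ))
    (h : ∮ w in C(0, R), Complex.exp ((w ^ m)⁻¹) * c w = 0) :
    ∃ d, DifferentiableOn ℂ d (puncturedBall R) ∧ ∀ z ∈ puncturedBall R, Pop m d z = c z := by
  have hinv : DifferentiableOn ℂ (fun z : ℂ => (z ^ m)⁻¹) (puncturedBall ρ) := fun z hz =>
    (hasDerivAt_inv_pow hz.2).differentiableAt.differentiableWithinAt
  have hu : DifferentiableOn ℂ (fun z : ℂ × ℂ => Complex.exp ((z.2 ^ m)⁻¹) * c z.2)
      (univ ×ˢ puncturedBall ρ) :=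
    (hinv.cexp.mul hc).comp (t := puncturedBall ρ) (f := Prod.snd) differentiableOn_snd
      fun z hz => hz.2
  set u : ℂ × ℂ → ℂ := fun z => Complex.exp ((z.2 ^ m)⁻¹) * c z.2 with hu_def
  have hG : ∀ z ∈ puncturedBall R,
      HasDerivAt (fun y => prim2 R u (0, y)) (Complex.exp ((z ^ m)⁻¹) * c z) z := by
    intro z hz
    obtain ⟨h1, h2⟩ := prim2_spec isOpen_univ hR₀ hR hu (z := (0, z)) ⟨mem_univ _, hz⟩
    have h3 := hasDerivAt_pd2 h1
    have h4 : res2 R u 0 = 0 := by rw [res2, h, mul_zero]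
    rw [h2] at h3
    simpa [h4] using h3
  have hd : ∀ z ∈ puncturedBall R,
      HasDerivAt (fun y => Complex.exp (-(y ^ m)⁻¹) * prim2 R u (0, y))
        (c z + (m : ℂ) * z ^ (-(m : ℤ) - 1) *
          (Complex.exp (-(z ^ m)⁻¹) * prim2 R u (0, z))) z := by
    intro z hz
    refine ((hasDerivAt_inv_pow hz.2).neg.cexp.mul (hG z hz)).congr_deriv ?_
    have he : Complex.exp (-(z ^ m)⁻¹) * Complex.exp ((z ^ m)⁻¹) = 1 := by
      rw [← Complex.exp_add, neg_add_cancel, Complex.exp_zero]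
    simp only [Pi.neg_apply, neg_neg]
    linear_combination c z * he
  refine ⟨_, fun z hz => (hd z hz).differentiableAt.differentiableWithinAt, fun z hz => ?_⟩
  rw [Pop, (hd z hz).deriv]
  ring

/-- Modulo meromorphic germs, `Pop` is surjective. -/
theorem exists_sub_Pop_meromorphicAt (hm : 0 < m) (hc : PuncturedHol c) :
    ∃ d, PuncturedHol d ∧ MeromorphicAt (fun z => c z - Pop m d z) 0 := by
  obtain ⟨ρ, hρ, hc⟩ := hc
  have hR : ρ / 2 < ρ := by linarith
  have hR₀ : 0 < ρ / 2 := by linarith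
  have hsph := sphere_subset_puncturedBall hR₀ hR
  have hexp : DifferentiableOn ℂ (fun z : ℂ => Complex.exp ((z ^ m)⁻¹)) (puncturedBall ρ) :=
    DifferentiableOn.cexp fun z hz =>
      (hasDerivAt_inv_pow hz.2).differentiableAt.differentiableWithinAt
  obtain ⟨n, hn⟩ : ∃ n : ℕ, ∮ w in C(0, ρ / 2), Complex.exp ((w ^ m)⁻¹) * w ^ n ≠ 0 := by
    by_contra! hcon
    exact not_exists_extension_exp hm hR₀
      (exists_extension_of_circleIntegral_pow_eq_zero hR₀ hR hexp hcon)
  set k : ℂ := (∮ w in C(0, ρ / 2), Complex.exp ((w ^ m)⁻¹) * c w) /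
    ∮ w in C(0, ρ / 2), Complex.exp ((w ^ m)⁻¹) * w ^ n with hk
  have hi : ∀ f : ℂ → ℂ, DifferentiableOn ℂ f (puncturedBall ρ) →
      CircleIntegrable (fun w => Complex.exp ((w ^ m)⁻¹) * f w) 0 (ρ / 2) := fun f hf =>
    ((hexp.mul hf).continuousOn.mono hsph).circleIntegrable hR₀.le
  have hpow : DifferentiableOn ℂ (fun w : ℂ => w ^ n) (puncturedBall ρ) := by fun_prop
  obtain ⟨d, hd, h⟩ := exists_Pop_eq_of_circleIntegral_eq_zero (m := m)
    (c := fun z => c z - k * z ^ n) hR₀ hR (hc.sub (hpow.const_mul k)) (by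
      have e : ∀ w, Complex.exp ((w ^ m)⁻¹) * (c w - k * w ^ n) =
          Complex.exp ((w ^ m)⁻¹) * c w - k * (Complex.exp ((w ^ m)⁻¹) * w ^ n) := fun w => by
        ring
      simp_rw [e]
      rw [circleIntegral.integral_sub (hi c hc), circleIntegral.integral_const_mul, hk,
        div_mul_cancel₀ _ hn, sub_self]
      exact (continuousOn_const.mul ((hexp.mul hpow).continuousOn.mono hsph)).circleIntegrable
        hR₀.le)
  refine ⟨d, ⟨ρ / 2, hR₀, hd⟩, ?_⟩
  have hmero : MeromorphicAt (fun z : ℂ => k * z ^ n) 0 := by fun_prop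
  refine hmero.congr (eventually_punctured.2 ⟨ρ / 2, hR₀, fun z hz => ?_⟩)
  simp only [h z hz]
  ring

/-! ### Moments -/

theorem circleIntegrable_mul_pow (hR₀ : 0 < R) (hR : R < ρ)
    (hu : DifferentiableOn ℂ u (puncturedBall ρ)) (k : ℕ) :
    CircleIntegrable (fun w => u w * w ^ k) 0 R :=
  ((hu.continuousOn.mono (sphere_subset_puncturedBall hR₀ hR)).mul
    (by fun_prop)).circleIntegrable hR₀.le

theorem meromorphicAt_of_circleIntegral_eq_zero (hR₀ : 0 < R) (hR : R < ρ)
    (hu : DifferentiableOn ℂ u (puncturedBall ρ)) (N : ℕ)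
    (h : ∀ k ≥ N, ∮ w in C(0, R), u w * w ^ k = 0) : MeromorphicAt u 0 := by
  obtain ⟨g, hg, hgu⟩ := exists_extension_of_circleIntegral_pow_eq_zero (f := fun w => w ^ N * u w)
    hR₀ hR (DifferentiableOn.mul (by fun_prop) hu) fun n => by
      refine Eq.trans ?_ (h (n + N) (Nat.le_add_left N n))
      congr 1
      funext w
      ring
  exact meromorphicAt_of_analytic hR₀ hg hgu

theorem exists_circleIntegral_eq_zero (hR₀ : 0 < R) (hR : R < ρ)
    (hu : DifferentiableOn ℂ u (puncturedBall ρ)) (h : MeromorphicAt u 0) :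
    ∃ N : ℕ, ∀ k ≥ N, ∮ w in C(0, R), u w * w ^ k = 0 := by
  obtain ⟨r₁, hr₁, N, hN⟩ := exists_analytic_of_meromorphicAt h
  refine ⟨N, fun k hk => ?_⟩
  obtain ⟨r, hr, h1, h2⟩ : ∃ r > 0, r < r₁ ∧ r ≤ R :=
    ⟨min (r₁ / 2) R, lt_min (by linarith) hR₀,
      (min_le_left _ _).trans_lt (by linarith), min_le_right _ _⟩
  rw [circleIntegral_eq_of_puncturedBall (f := fun w => u w * w ^ k)
    (DifferentiableOn.mul hu (by fun_prop)) hr h2 hR]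
  have hd : DifferentiableOn ℂ (fun w => u w * w ^ k) (ball 0 r₁) := by
    have : DifferentiableOn ℂ (fun w => w ^ N * u w * w ^ (k - N)) (ball 0 r₁) :=
      hN.mul (by fun_prop)
    refine this.congr fun w _ => ?_
    rw [← Nat.sub_add_cancel hk, pow_add, Nat.sub_add_cancel hk]
    ring
  exact ((hd.mono (closedBall_subset_ball h1)).diffContOnCl_ball
    le_rfl).circleIntegral_eq_zero hr.le

theorem circleIntegral_Pop_mul_pow (hR₀ : 0 < R) (hR : R < ρ)
    (hu : DifferentiableOn ℂ u (puncturedBall ρ)) (k : ℕ) :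
    ∮ w in C(0, R), Pop m u w * w ^ (k + m + 1) =
      -((k + m + 1) * (∮ w in C(0, R), u w * w ^ (k + m)) + m * ∮ w in C(0, R), u w * w ^ k) := by
  have hsph := sphere_subset_puncturedBall hR₀ hR
  have h1 : ∮ w in C(0, R), (deriv u w * w ^ (k + m + 1) +
      u w * ((k + m + 1 : ℂ) * w ^ (k + m))) = 0 := by
    refine circleIntegral.integral_eq_zero_of_hasDerivWithinAt
      (f := fun w => u w * w ^ (k + m + 1)) hR₀.le fun w hw => ?_
    have hd := (hu.differentiableAt ((isOpen_puncturedBall ρ).mem_nhds (hsph hw))).hasDerivAt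
    have := (hd.fun_mul (hasDerivAt_pow (k + m + 1) w)).hasDerivWithinAt (s := sphere 0 R)
    simpa using this
  have h2 : ∮ w in C(0, R), Pop m u w * w ^ (k + m + 1) =
      ∮ w in C(0, R), ((deriv u w * w ^ (k + m + 1) + u w * ((k + m + 1 : ℂ) * w ^ (k + m))) -
        ((k + m + 1 : ℂ) * (u w * w ^ (k + m)) + m * (u w * w ^ k))) := by
    refine circleIntegral.integral_congr hR₀.le fun w hw => ?_
    have hw0 := (hsph hw).2
    have hz : w ^ (-(m : ℤ) - 1) * w ^ (k + m + 1) = w ^ k := by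
      rw [← zpow_natCast, ← zpow_natCast, ← zpow_add₀ hw0]
      congr 1
      push_cast
      ring
    simp only [Pop]
    linear_combination (-(m * u w)) * hz
  have hi := circleIntegrable_mul_pow hR₀ hR hu
  have hc : ContinuousOn u (sphere 0 R) := hu.continuousOn.mono hsph
  have hc' : ContinuousOn (deriv u) (sphere 0 R) :=
    (hu.deriv (isOpen_puncturedBall ρ)).continuousOn.mono hsph
  have i1 : CircleIntegrable (fun w => (k + m + 1 : ℂ) * (u w * w ^ (k + m))) 0 R :=
    ContinuousOn.circleIntegrable hR₀.le (by fun_prop)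
  have i2 : CircleIntegrable (fun w => (m : ℂ) * (u w * w ^ k)) 0 R :=
    ContinuousOn.circleIntegrable hR₀.le (by fun_prop)
  rw [h2, circleIntegral.integral_sub, h1, circleIntegral.integral_add i1 i2,
    circleIntegral.integral_const_mul, circleIntegral.integral_const_mul, zero_sub]
  · exact ContinuousOn.circleIntegrable hR₀.le (by fun_prop)
  · exact i1.add i2

end

/-! ### A basis of the kernel in one variable -/

theorem hasSum_circleIntegral_of_summable {F : ℕ → ℂ → ℂ} {R : ℝ} {a : ℕ → ℝ} (hR : 0 ≤ R)
    (hF : ∀ n, ContinuousOn (F n) (sphere 0 R)) (ha : Summable a)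
    (h : ∀ n, ∀ w ∈ sphere (0 : ℂ) R, ‖F n w‖ ≤ a n) :
    HasSum (fun n => ∮ w in C(0, R), F n w) (∮ w in C(0, R), ∑' n, F n w) := by
  have hmem : ∀ t, circleMap 0 R t ∈ sphere (0 : ℂ) R := circleMap_mem_sphere 0 hR
  have hs : ∀ t, Summable fun n => F n (circleMap 0 R t) := fun t =>
    Summable.of_norm_bounded ha fun n => h n _ (hmem t)
  refine intervalIntegral.hasSum_integral_of_dominated_convergence (fun n _ => R * a n)
    (fun n => Continuous.aestronglyMeasurable ?_) (fun n => .of_forall fun t _ => ?_)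
    (.of_forall fun t _ => ha.mul_left R) intervalIntegrable_const
    (.of_forall fun t _ => ?_)
  · simp only [deriv_circleMap]
    exact ((continuous_circleMap 0 R).mul continuous_const).smul
      ((hF n).comp_continuous (continuous_circleMap 0 R) hmem)
  · rw [norm_smul, deriv_circleMap, norm_mul, Complex.norm_I, mul_one, norm_circleMap_zero,
      abs_of_nonneg hR]
    exact mul_le_mul_of_nonneg_left (h n _ (hmem t)) hR
  · exact (hs t).hasSum.const_smul _

/-- The coefficients of the solution `kernelFun`. -/
noncomputable def kernelCoeff (m s : ℕ) : ℕ → ℂ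
  | 0 => 1
  | l + 1 => -((m : ℂ) / (m * l + s + m + 1)) * kernelCoeff m s l

/-- The series `∑ₗ βₗ z^{-(ml + s + 1)}`, which is mapped by `Pop m` to a meromorphic germ. -/
noncomputable def kernelFun (m s : ℕ) (z : ℂ) : ℂ :=
  ∑' l, kernelCoeff m s l * (z ^ (m * l + s + 1))⁻¹

section

variable {u : ℂ → ℂ} {m s : ℕ} {R ρ : ℝ}

theorem kernelCoeff_denom_ne_zero (l : ℕ) : (m * l + s + m + 1 : ℂ) ≠ 0 := by
  exact_mod_cast Nat.succ_ne_zero (m * l + s + m)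

theorem kernelCoeff_ne_zero (hm : 0 < m) (l : ℕ) : kernelCoeff m s l ≠ 0 := by
  induction l with
  | zero => exact one_ne_zero
  | succ l ih =>
    refine mul_ne_zero (neg_ne_zero.2 (div_ne_zero ?_ (kernelCoeff_denom_ne_zero l))) ih
    exact_mod_cast hm.ne'

theorem norm_kernelCoeff_le (l : ℕ) : ‖kernelCoeff m s l‖ ≤ 1 / (l.factorial : ℝ) := by
  induction l with
  | zero => simp [kernelCoeff]
  | succ l ih =>
    have h : ‖(m : ℂ) / (m * l + s + m + 1)‖ ≤ 1 / ((l + 1 : ℕ) : ℝ) := by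
      have e : (m * l + s + m + 1 : ℂ) = ((m * l + s + m + 1 : ℕ) : ℂ) := by push_cast; ring
      rw [e, norm_div, Complex.norm_natCast, Complex.norm_natCast,
        div_le_div_iff₀ (by positivity) (by positivity)]
      norm_cast
      nlinarith
    rw [kernelCoeff, norm_mul, norm_neg, Nat.factorial_succ]
    refine (mul_le_mul h ih (norm_nonneg _) (by positivity)).trans_eq ?_
    push_cast
    field_simp

theorem summable_kernel_bound (m s : ℕ) (t : ℝ) :
    Summable fun l : ℕ => 1 / (l.factorial : ℝ) * t ^ (m * l + s + 1) := by
  refine ((Real.summable_pow_div_factorial (t ^ m)).mul_left (t ^ (s + 1))).congr fun l => ?_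
  rw [add_assoc, pow_add t (m * l), pow_mul]
  ring

theorem norm_kernel_term_le {r : ℝ} (hr : 0 < r) {z : ℂ} (hz : r ≤ ‖z‖) (l : ℕ) :
    ‖kernelCoeff m s l * (z ^ (m * l + s + 1))⁻¹‖ ≤
      1 / (l.factorial : ℝ) * r⁻¹ ^ (m * l + s + 1) := by
  rw [norm_mul, norm_inv, norm_pow, ← inv_pow]
  have : ‖z‖⁻¹ ≤ r⁻¹ := inv_anti₀ hr hz
  gcongr
  exact norm_kernelCoeff_le l

theorem differentiableOn_kernel_term (l : ℕ) {U : Set ℂ} (hU : ∀ z ∈ U, z ≠ 0) :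
    DifferentiableOn ℂ (fun z => kernelCoeff m s l * (z ^ (m * l + s + 1))⁻¹) U :=
  DifferentiableOn.const_mul
    (DifferentiableOn.inv (by fun_prop) fun z hz => pow_ne_zero _ (hU z hz)) _

theorem differentiableOn_kernelFun : DifferentiableOn ℂ (kernelFun m s) (puncturedBall ρ) := by
  intro z hz
  have hz0 : 0 < ‖z‖ := norm_pos_iff.2 hz.2
  have ho : IsOpen {y : ℂ | ‖z‖ / 2 < ‖y‖} := isOpen_lt continuous_const continuous_norm
  have h : DifferentiableOn ℂ (kernelFun m s) {y : ℂ | ‖z‖ / 2 < ‖y‖} := by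
    refine Complex.differentiableOn_tsum_of_summable_norm
      (summable_kernel_bound m s (‖z‖ / 2)⁻¹) (fun l => ?_) ho fun l w hw => ?_
    · exact differentiableOn_kernel_term l fun y hy =>
        norm_pos_iff.1 ((half_pos hz0).trans hy)
    · exact norm_kernel_term_le (half_pos hz0) (le_of_lt hw) l
  exact (h.differentiableAt (ho.mem_nhds (half_lt_self hz0))).differentiableWithinAt

theorem circleIntegral_inv_pow_mul_pow (hR : 0 < R) (j k : ℕ) :
    ∮ w in C(0, R), (w ^ (j + 1))⁻¹ * w ^ k = if j = k then 2 * Real.pi * Complex.I else 0 := by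
  have h : ∮ w in C(0, R), (w ^ (j + 1))⁻¹ * w ^ k =
      ∮ w in C(0, R), (w - 0) ^ ((k : ℤ) - j - 1) := by
    refine circleIntegral.integral_congr hR.le fun w hw => ?_
    have hw0 : w ≠ 0 := norm_pos_iff.1 (by rw [mem_sphere_zero_iff_norm.1 hw]; exact hR)
    simp only [sub_zero]
    rw [← zpow_natCast, ← zpow_natCast, ← zpow_neg, ← zpow_add₀ hw0]
    congr 1
    push_cast
    ring
  rw [h]
  split_ifs with hjk
  · subst hjk
    rw [← circleIntegral.integral_sub_center_inv 0 hR.ne']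
    simp
  · exact circleIntegral.integral_sub_zpow_of_ne (by omega) 0 0 R

theorem hasSum_circleIntegral_kernelFun (hR : 0 < R) (k : ℕ) :
    HasSum (fun l => kernelCoeff m s l * if m * l + s = k then 2 * Real.pi * Complex.I else 0)
      (∮ w in C(0, R), kernelFun m s w * w ^ k) := by
  have hne : ∀ w ∈ sphere (0 : ℂ) R, w ≠ 0 := fun w hw =>
    norm_pos_iff.1 (by rw [mem_sphere_zero_iff_norm.1 hw]; exact hR)
  have h := hasSum_circleIntegral_of_summable (R := R)
    (F := fun l w => kernelCoeff m s l * (w ^ (m * l + s + 1))⁻¹ * w ^ k) hR.le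
    (fun l => (differentiableOn_kernel_term l hne).continuousOn.mul (by fun_prop))
    ((summable_kernel_bound m s R⁻¹).mul_right (R ^ k)) fun l w hw => by
      have hw' := mem_sphere_zero_iff_norm.1 hw
      rw [norm_mul, norm_pow, hw']
      exact mul_le_mul_of_nonneg_right (norm_kernel_term_le hR hw'.ge l) (by positivity)
  simp_rw [tsum_mul_right, mul_assoc, circleIntegral.integral_const_mul,
    circleIntegral_inv_pow_mul_pow hR] at h
  simpa only [kernelFun, mul_assoc] using h

theorem circleIntegral_kernelFun (hR : 0 < R) {r : ℕ} (hs : s < m) (hr : r < m) (l : ℕ) :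
    ∮ w in C(0, R), kernelFun m s w * w ^ (m * l + r) =
      if s = r then kernelCoeff m s l * (2 * Real.pi * Complex.I) else 0 := by
  have h := hasSum_circleIntegral_kernelFun (m := m) (s := s) hR (m * l + r)
  have key : ∀ l', m * l' + s = m * l + r → l' = l ∧ s = r := by
    intro l' e
    have h1 : (m * l' + s) % m = (m * l + r) % m := by rw [e]
    rw [Nat.mul_add_mod, Nat.mul_add_mod, Nat.mod_eq_of_lt hs, Nat.mod_eq_of_lt hr] at h1
    subst h1
    exact ⟨Nat.eq_of_mul_eq_mul_left (by omega) (Nat.add_right_cancel e), rfl⟩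
  refine h.unique ?_
  convert hasSum_single (f := fun l' => kernelCoeff m s l' *
    if m * l' + s = m * l + r then 2 * Real.pi * Complex.I else 0) l ?_ using 1
  · split_ifs with h1 h2 h2
    · rfl
    · exact absurd (by rw [h1]) h2
    · exact absurd (key l h2).2 h1
    · simp
  · intro l' hl'
    rw [if_neg fun e => hl' (key l' e).1, mul_zero]

theorem meromorphicAt_Pop_kernelFun (hm : 0 < m) (hs : s < m) :
    MeromorphicAt (Pop m (kernelFun m s)) 0 := by
  refine meromorphicAt_of_circleIntegral_eq_zero (R := 1) (ρ := 2) one_pos one_lt_two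
    (differentiableOn_Pop differentiableOn_kernelFun) (m + 1) fun k hk => ?_
  obtain ⟨j, rfl⟩ : ∃ j, k = j + m + 1 := ⟨k - m - 1, by omega⟩
  rw [circleIntegral_Pop_mul_pow one_pos one_lt_two differentiableOn_kernelFun]
  have hj := Nat.div_add_mod j m
  have hlt := Nat.mod_lt j hm
  generalize j / m = l at hj
  generalize j % m = r at hj hlt
  subst hj
  rw [circleIntegral_kernelFun one_pos hs hlt,
    show m * l + r + m = m * (l + 1) + r by ring, circleIntegral_kernelFun one_pos hs hlt]
  split_ifs with h
  · subst h
    have := kernelCoeff_denom_ne_zero (m := m) (s := s) l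
    rw [kernelCoeff]
    push_cast
    field_simp
    ring
  · simp

theorem circleIntegral_sum_kernelFun (hR : 0 < R) (c : Fin m → ℂ) (r : Fin m) (l : ℕ) :
    ∮ w in C(0, R), (∑ s, c s * kernelFun m s w) * w ^ (m * l + r) =
      c r * (kernelCoeff m r l * (2 * Real.pi * Complex.I)) := by
  have hR2 : R < 2 * R := by linarith
  simp_rw [Finset.sum_mul, mul_assoc]
  rw [circleIntegral.integral_fun_sum]
  · simp_rw [circleIntegral.integral_const_mul]
    rw [Finset.sum_eq_single r]
    · rw [circleIntegral_kernelFun hR r.2 r.2, if_pos rfl, mul_assoc 2]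
    · intro s _ hsr
      rw [circleIntegral_kernelFun hR s.2 r.2, if_neg fun h => hsr (Fin.ext h), mul_zero]
    · exact fun h => absurd (Finset.mem_univ r) h
  · intro s _
    exact (circleIntegrable_mul_pow hR hR2 differentiableOn_kernelFun _).const_smul (a := c s)

theorem eq_zero_of_meromorphicAt_sum_kernelFun (hm : 0 < m) {c : Fin m → ℂ}
    (h : MeromorphicAt (fun z => ∑ s, c s * kernelFun m s z) 0) : c = 0 := by
  have hd : DifferentiableOn ℂ (fun z => ∑ s, c s * kernelFun m s z) (puncturedBall 2) :=
    DifferentiableOn.fun_sum fun s _ => differentiableOn_kernelFun.const_mul _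
  obtain ⟨N, hN⟩ := exists_circleIntegral_eq_zero one_pos one_lt_two hd h
  funext r
  have h1 := hN (m * N + r) (by nlinarith [Nat.le_mul_of_pos_left N hm])
  rw [circleIntegral_sum_kernelFun one_pos] at h1
  exact (mul_eq_zero.1 h1).resolve_right
    (mul_ne_zero (kernelCoeff_ne_zero hm N) Complex.two_pi_I_ne_zero)

theorem exists_sub_sum_kernelFun_meromorphicAt (hm : 0 < m) (hu : PuncturedHol u)
    (h : MeromorphicAt (Pop m u) 0) :
    ∃ c : Fin m → ℂ, MeromorphicAt (fun z => u z - ∑ s, c s * kernelFun m s z) 0 := by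
  obtain ⟨ρ, hρ, hu⟩ := hu
  have hR : ρ / 2 < ρ := by linarith
  have hR₀ : 0 < ρ / 2 := by linarith
  obtain ⟨N, hN⟩ := exists_circleIntegral_eq_zero hR₀ hR (differentiableOn_Pop hu) h
  have hpi := Complex.two_pi_I_ne_zero
  set c : Fin m → ℂ := fun s => (∮ w in C(0, ρ / 2), u w * w ^ (m * N + s)) /
    (kernelCoeff m s N * (2 * Real.pi * Complex.I)) with hc
  have hmom : ∀ l ≥ N, ∀ s : Fin m, ∮ w in C(0, ρ / 2), u w * w ^ (m * l + s) =
      c s * (kernelCoeff m s l * (2 * Real.pi * Complex.I)) := by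
    intro l hl s
    induction l, hl using Nat.le_induction with
    | base => rw [hc, div_mul_cancel₀ _ (mul_ne_zero (kernelCoeff_ne_zero hm N) hpi)]
    | succ l hl ih =>
      have h1 := circleIntegral_Pop_mul_pow (m := m) hR₀ hR hu (m * l + s)
      rw [hN _ (by nlinarith [Nat.le_mul_of_pos_left l hm]), ih,
        show m * l + s + m = m * (l + 1) + s by ring] at h1
      have h2 := kernelCoeff_denom_ne_zero (m := m) (s := s) l
      rw [kernelCoeff]
      push_cast at h1
      field_simp
      linear_combination h1
  have hE : DifferentiableOn ℂ (fun z => ∑ s, c s * kernelFun m s z) (puncturedBall ρ) :=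
    DifferentiableOn.fun_sum fun s _ => differentiableOn_kernelFun.const_mul _
  refine ⟨c, meromorphicAt_of_circleIntegral_eq_zero hR₀ hR (hu.sub hE) (m * N) fun k hk => ?_⟩
  have hj := Nat.div_add_mod k m
  have hlt := Nat.mod_lt k hm
  have hNl : N ≤ k / m := (Nat.le_div_iff_mul_le hm).2 (by rwa [mul_comm])
  have h1 := hmom (k / m) hNl ⟨k % m, hlt⟩
  have h2 := circleIntegral_sum_kernelFun hR₀ c ⟨k % m, hlt⟩ (k / m)
  simp only [hj] at h1 h2
  simp only [sub_mul]
  rw [circleIntegral.integral_sub (circleIntegrable_mul_pow hR₀ hR hu k)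
    (circleIntegrable_mul_pow hR₀ hR hE k), h1, h2, sub_self]

theorem puncturedHol_kernelFun : PuncturedHol (kernelFun m s) :=
  ⟨1, one_pos, differentiableOn_kernelFun⟩

end

/-! ### Cohomology -/

theorem finrank_quotient_eq_of_basis_mod {V : Type*} [AddCommGroup V] [Module ℂ V] {m : ℕ}
    {K L : Submodule ℂ V} (e : Fin m → V) (he : ∀ i, e i ∈ K)
    (hspan : ∀ x ∈ K, ∃ c : Fin m → ℂ, x - ∑ i, c i • e i ∈ L)
    (hind : ∀ c : Fin m → ℂ, ∑ i, c i • e i ∈ L → c = 0) :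
    Module.finrank ℂ (K ⧸ L.comap K.subtype) = m := by
  set e' : Fin m → K := fun i => ⟨e i, he i⟩
  set T := (L.comap K.subtype).mkQ ∘ₗ Fintype.linearCombination ℂ e'
  have hT : ∀ c, T c = Submodule.Quotient.mk (∑ i, c i • e' i) := fun c => by
    rw [LinearMap.comp_apply, Fintype.linearCombination_apply]
    rfl
  have hcoe : ∀ c : Fin m → ℂ, ((∑ i, c i • e' i : K) : V) = ∑ i, c i • e i := fun c => by
    simp [e']
  have hbij : Bijective T := by
    refine ⟨(injective_iff_map_eq_zero T).2 fun c hc => hind c ?_, fun q => ?_⟩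
    · rw [hT, Submodule.Quotient.mk_eq_zero, Submodule.mem_comap, Submodule.subtype_apply,
        hcoe] at hc
      exact hc
    · obtain ⟨x, rfl⟩ := Submodule.Quotient.mk_surjective _ q
      obtain ⟨c, hc⟩ := hspan x x.2
      refine ⟨c, ?_⟩
      rw [hT, eq_comm, Submodule.Quotient.eq, Submodule.mem_comap, Submodule.subtype_apply,
        Submodule.coe_sub, hcoe]
      exact hc
  rw [← (LinearEquiv.ofBijective T hbij).finrank_eq, Module.finrank_fin_fun]

section

variable {f g u η : ℂ × ℂ → ℂ} {m : ℕ}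

theorem div_snd_mem_L2set (hf : f ∈ L2set) : (fun z => f z / z.2) ∈ L2set := by
  obtain ⟨ρ, hρ, N, g, hg, h⟩ := mem_L2set_iff.1 hf
  refine mem_L2set_iff.2 ⟨ρ, hρ, N, fun z => g z * (z.2)⁻¹, ?_, fun z hz => ?_⟩
  · exact hg.mul (differentiableOn_snd.inv fun z hz => hz.2.2)
  · simp only [h z hz]
    ring

theorem pd2_fst (b : ℂ → ℂ) : pd2 (fun z => b z.1) = 0 := by
  funext z
  simp [pd2]

theorem φ1_sub (hf : f ∈ Esp) (hg : g ∈ Esp) : φ1 m (f - g) =ᶠ[offAxes] φ1 m f - φ1 m g := by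
  filter_upwards [mem_Esp_iff_eventually.1 hf, mem_Esp_iff_eventually.1 hg] with z h1 h2
  have : pd1 (f - g) z = pd1 f z - pd1 g z :=
    ((hasDerivAt_pd1 h1).sub (hasDerivAt_pd1 h2)).deriv
  simp only [φ1, this, Pi.sub_apply]
  ring

theorem pd2_sub (hf : f ∈ Esp) (hg : g ∈ Esp) : pd2 (f - g) =ᶠ[offAxes] pd2 f - pd2 g := by
  filter_upwards [mem_Esp_iff_eventually.1 hf, mem_Esp_iff_eventually.1 hg] with z h1 h2
  exact ((hasDerivAt_pd2 h1).sub (hasDerivAt_pd2 h2)).deriv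

theorem pd2_neg (f : ℂ × ℂ → ℂ) : pd2 (-f) = -pd2 f := by
  funext z
  exact deriv.fun_neg

/-- Cocycles of degree `0` modulo `L2set`. -/
def kerφ (m : ℕ) : Submodule ℂ (ℂ × ℂ → ℂ) where
  carrier := {u | u ∈ Esp ∧ φ1 m u ∈ L2set ∧ φ2 u ∈ L2set}
  zero_mem' := ⟨espSubmodule.zero_mem, φ1_mem_L2set l2Submodule.zero_mem,
    pd2_mem_L2set l2Submodule.zero_mem⟩
  add_mem' := fun {_ _} hf hg => ⟨espSubmodule.add_mem hf.1 hg.1,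
    mem_L2set_congr (l2Submodule.add_mem hf.2.1 hg.2.1) (φ1_add hf.1 hg.1).symm,
    mem_L2set_congr (l2Submodule.add_mem hf.2.2 hg.2.2) (pd2_add hf.1 hg.1).symm⟩
  smul_mem' := fun c _ hf => ⟨espSubmodule.smul_mem c hf.1,
    mem_L2set_congr (l2Submodule.smul_mem c hf.2.1) (φ1_smul c hf.1).symm,
    mem_L2set_congr (l2Submodule.smul_mem c hf.2.2) (pd2_smul c hf.1).symm⟩

/-- Cocycles of degree `1` modulo `L2set`. -/
def kerψ (m : ℕ) : Submodule ℂ ((ℂ × ℂ → ℂ) × (ℂ × ℂ → ℂ)) where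
  carrier := {ω | ω.1 ∈ Esp ∧ ω.2 ∈ Esp ∧ ψop m ω.1 ω.2 ∈ L2set}
  zero_mem' := ⟨espSubmodule.zero_mem, espSubmodule.zero_mem,
    ψop_mem_L2set l2Submodule.zero_mem l2Submodule.zero_mem⟩
  add_mem' := fun {a b} ha hb => by
    refine ⟨espSubmodule.add_mem ha.1 hb.1, espSubmodule.add_mem ha.2.1 hb.2.1,
      mem_L2set_congr (l2Submodule.add_mem ha.2.2 hb.2.2) ?_⟩
    filter_upwards [φ1_add (m := m) ha.2.1 hb.2.1, pd2_add ha.1 hb.1] with z h1 h2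
    simp only [ψop_eq, φ2_eq, Pi.add_apply, Pi.sub_apply, Prod.fst_add, Prod.snd_add, h1, h2]
    ring
  smul_mem' := fun c a ha => by
    refine ⟨espSubmodule.smul_mem c ha.1, espSubmodule.smul_mem c ha.2.1,
      mem_L2set_congr (l2Submodule.smul_mem c ha.2.2) ?_⟩
    filter_upwards [φ1_smul (m := m) c ha.2.1, pd2_smul c ha.1] with z h1 h2
    simp only [ψop_eq, φ2_eq, Pi.smul_apply, Pi.sub_apply, Prod.smul_fst, Prod.smul_snd, h1, h2,
      smul_sub]

/-- Coboundaries of degree `1` modulo `L2set`. -/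
def imφ (m : ℕ) : Submodule ℂ ((ℂ × ℂ → ℂ) × (ℂ × ℂ → ℂ)) where
  carrier := {ω | ω.1 ∈ Esp ∧ ω.2 ∈ Esp ∧ ∃ u ∈ Esp,
    ω.1 - φ1 m u ∈ L2set ∧ ω.2 - φ2 u ∈ L2set}
  zero_mem' := ⟨espSubmodule.zero_mem, espSubmodule.zero_mem, 0, espSubmodule.zero_mem,
    l2Submodule.sub_mem l2Submodule.zero_mem (φ1_mem_L2set l2Submodule.zero_mem),
    l2Submodule.sub_mem l2Submodule.zero_mem (pd2_mem_L2set l2Submodule.zero_mem)⟩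
  add_mem' := by
    rintro a b ⟨ha1, ha2, u, hu, h1, h2⟩ ⟨hb1, hb2, v, hv, h3, h4⟩
    refine ⟨espSubmodule.add_mem ha1 hb1, espSubmodule.add_mem ha2 hb2, u + v,
      espSubmodule.add_mem hu hv, mem_L2set_congr (l2Submodule.add_mem h1 h3) ?_,
      mem_L2set_congr (l2Submodule.add_mem h2 h4) ?_⟩
    · filter_upwards [φ1_add (m := m) hu hv] with z h
      simp only [Pi.add_apply, Pi.sub_apply, Prod.fst_add, h]
      ring
    · filter_upwards [pd2_add hu hv] with z h
      simp only [Pi.add_apply, Pi.sub_apply, Prod.snd_add, φ2_eq, h]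
      ring
  smul_mem' := by
    rintro c a ⟨ha1, ha2, u, hu, h1, h2⟩
    refine ⟨espSubmodule.smul_mem c ha1, espSubmodule.smul_mem c ha2, c • u,
      espSubmodule.smul_mem c hu, mem_L2set_congr (l2Submodule.smul_mem c h1) ?_,
      mem_L2set_congr (l2Submodule.smul_mem c h2) ?_⟩
    · filter_upwards [φ1_smul (m := m) c hu] with z h
      simp only [Pi.smul_apply, Pi.sub_apply, Prod.smul_fst, h, smul_sub]
    · filter_upwards [pd2_smul c hu] with z h
      simp only [Pi.smul_apply, Pi.sub_apply, Prod.smul_snd, φ2_eq, h, smul_sub]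

theorem imφ_le_kerψ (m : ℕ) : imφ m ≤ kerψ m := by
  rintro ω ⟨h1, h2, u, hu, h3, h4⟩
  refine ⟨h1, h2, mem_L2set_congr (l2Submodule.add_mem (ψop_mem_L2set (m := m) h3 h4)
    (ψop_φ (m := m) hu)) ?_⟩
  filter_upwards [φ1_sub (m := m) h2 (pd2_mem_Esp hu),
    pd2_sub h1 (φ1_mem_Esp (m := m) hu)] with z e1 e2
  simp only [ψop_eq, Pi.add_apply, Pi.sub_apply, φ2_eq] at e1 e2 ⊢
  rw [e1, e2]
  ring

theorem finrank_kerφ_quotient (hm : 0 < m) :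
    Module.finrank ℂ (kerφ m ⧸ l2Submodule.comap (kerφ m).subtype) = m := by
  have hsum : ∀ c : Fin m → ℂ, ∑ s, c s • (fun z : ℂ × ℂ => kernelFun m s z.1) =
      fun z => ∑ s, c s * kernelFun m s z.1 := fun c => by
    funext z
    simp [Finset.sum_apply]
  refine finrank_quotient_eq_of_basis_mod (fun s z => kernelFun m s z.1) (fun s => ?_)
    (fun u hu => ?_) fun c hc => ?_
  · refine ⟨puncturedHol_kernelFun.mem_Esp, (meromorphicAt_Pop_kernelFun hm s.2).mem_L2set, ?_⟩
    rw [φ2_eq, pd2_fst]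
    exact l2Submodule.zero_mem
  · obtain ⟨huE, h1, h2⟩ := hu
    obtain ⟨b, hb, hub⟩ := exists_sub_fst_mem_L2set huE h2
    have hPb : (fun z : ℂ × ℂ => Pop m b z.1) ∈ L2set := by
      refine mem_L2set_congr (l2Submodule.sub_mem h1 (φ1_mem_L2set (m := m) hub)) ?_
      filter_upwards [φ1_sub (m := m) huE hb.mem_Esp] with z h
      rw [Pi.sub_apply, h, Pi.sub_apply, sub_sub_cancel, φ1_fst]
    have hmero : MeromorphicAt (Pop m b) 0 := by
      refine meromorphicAt_of_pd2_add_div_mem (w := 0) espSubmodule.zero_mem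
        (mem_L2set_congr (div_snd_mem_L2set hPb) (.of_eq ?_))
      funext z
      simp [pd2]
    obtain ⟨c, hc⟩ := exists_sub_sum_kernelFun_meromorphicAt hm hb hmero
    refine ⟨c, ?_⟩
    have := l2Submodule.add_mem hub hc.mem_L2set
    rw [hsum]
    convert this using 1
    funext z
    simp
  · rw [hsum] at hc
    refine eq_zero_of_meromorphicAt_sum_kernelFun hm
      (meromorphicAt_of_pd2_add_div_mem (w := 0) espSubmodule.zero_mem
        (mem_L2set_congr (div_snd_mem_L2set hc) (.of_eq ?_)))
    funext z
    simp [pd2]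

theorem finrank_kerψ_quotient (hm : 0 < m) :
    Module.finrank ℂ (kerψ m ⧸ (imφ m).comap (kerψ m).subtype) = m := by
  have hsum : ∀ c : Fin m → ℂ,
      ∑ s, c s • ((0, fun z => kernelFun m s z.1 / z.2) : (ℂ × ℂ → ℂ) × (ℂ × ℂ → ℂ)) =
      (0, fun z => (∑ s, c s * kernelFun m s z.1) / z.2) := fun c => by
    refine Prod.ext ?_ ?_
    · simp [Prod.fst_sum]
    · funext z
      simp [Prod.snd_sum, Finset.sum_apply, Finset.sum_div, mul_div_assoc]
  refine finrank_quotient_eq_of_basis_mod (fun s => (0, fun z => kernelFun m s z.1 / z.2))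
    (fun s => ?_) (fun ω hω => ?_) fun c hc => ?_
  · refine ⟨espSubmodule.zero_mem, puncturedHol_kernelFun.div_mem_Esp, ?_⟩
    rw [ψop_eq, φ1_fst_div]
    exact l2Submodule.sub_mem (meromorphicAt_Pop_kernelFun hm s.2).div_mem_L2set
      (pd2_mem_L2set l2Submodule.zero_mem)
  · obtain ⟨h1, h2, hψ⟩ := hω
    obtain ⟨v, hv, c, hc, hω2⟩ := exists_pd2_add_div h2
    have hφv : φ1 m v ∈ Esp := φ1_mem_Esp hv
    have hwE : φ1 m v - ω.1 ∈ Esp := espSubmodule.sub_mem hφv h1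
    have hres : (fun z => pd2 (φ1 m v - ω.1) z + Pop m c z.1 / z.2) ∈ L2set := by
      refine mem_L2set_congr hψ ?_
      filter_upwards [φ1_congr (m := m) hω2, φ1_add (m := m) (pd2_mem_Esp hv) hc.div_mem_Esp,
        pd2_φ1 (m := m) hv, pd2_sub hφv h1] with z e1 e2 e3 e4
      rw [ψop_eq, Pi.sub_apply, e1, e4, Pi.sub_apply, e3, φ2_eq]
      refine (congrArg (· - pd2 ω.1 z) e2).trans ?_
      rw [Pi.add_apply, φ1_fst_div]
      ring
    have hPc := meromorphicAt_of_pd2_add_div_mem hwE hres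
    obtain ⟨k, hk⟩ := exists_sub_sum_kernelFun_meromorphicAt hm hc hPc
    have hw2 : pd2 (φ1 m v - ω.1) ∈ L2set := by
      refine mem_L2set_congr (l2Submodule.sub_mem hres hPc.div_mem_L2set) (.of_eq ?_)
      funext z
      simp
    obtain ⟨b, hb, hwb⟩ := exists_sub_fst_mem_L2set hwE hw2
    obtain ⟨d, hd, hbd⟩ := exists_sub_Pop_meromorphicAt hm hb
    have hE : (fun z : ℂ × ℂ => (∑ s, k s * kernelFun m s z.1) / z.2) ∈ Esp :=
      PuncturedHol.div_mem_Esp (b := fun x => ∑ s, k s * kernelFun m s x) ⟨1, one_pos,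
        DifferentiableOn.fun_sum fun s _ => differentiableOn_kernelFun.const_mul _⟩
    refine ⟨k, ?_⟩
    rw [hsum]
    refine ⟨espSubmodule.sub_mem h1 espSubmodule.zero_mem, espSubmodule.sub_mem h2 hE,
      v - (fun z : ℂ × ℂ => d z.1), espSubmodule.sub_mem hv hd.mem_Esp,
      mem_L2set_congr (l2Submodule.neg_mem (l2Submodule.add_mem hwb hbd.mem_L2set)) ?_,
      mem_L2set_congr hk.div_mem_L2set ?_⟩
    · filter_upwards [φ1_sub (m := m) hv hd.mem_Esp] with z e
      simp only [Pi.sub_apply, Pi.neg_apply, Pi.add_apply, Prod.fst_sub, Pi.zero_apply, e, φ1_fst]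
      ring
    · filter_upwards [pd2_sub hv hd.mem_Esp, hω2] with z e1 e2
      rw [Pi.sub_apply, φ2_eq, e1, Prod.snd_sub, Pi.sub_apply, e2, pd2_fst]
      simp only [Pi.sub_apply, Pi.zero_apply]
      ring
  · rw [hsum] at hc
    obtain ⟨-, -, u, hu, -, h⟩ := hc
    refine eq_zero_of_meromorphicAt_sum_kernelFun hm
      (meromorphicAt_of_pd2_add_div_mem (w := -u) (espSubmodule.neg_mem hu)
        (mem_L2set_congr h (.of_eq ?_)))
    funext z
    rw [pd2_neg, Pi.sub_apply, Pi.neg_apply, φ2_eq]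
    ring

theorem exists_sub_ψop_mem_L2set (hm : 0 < m) (hη : η ∈ Esp) :
    ∃ ω₁ ∈ Esp, ∃ ω₂ ∈ Esp, η - ψop m ω₁ ω₂ ∈ L2set := by
  obtain ⟨v, hv, c, hc, h⟩ := exists_pd2_add_div hη
  obtain ⟨d, hd, hcd⟩ := exists_sub_Pop_meromorphicAt hm hc
  refine ⟨-v, espSubmodule.neg_mem hv, fun z => d z.1 / z.2, hd.div_mem_Esp,
    mem_L2set_congr hcd.div_mem_L2set ?_⟩
  filter_upwards [h] with z hz
  rw [Pi.sub_apply, hz, ψop_eq, φ1_fst_div, φ2_eq, pd2_neg, Pi.sub_apply, Pi.neg_apply]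
  ring

end

end

/-- Proposition 4.9 (prop:rddimj2) of the paper for the model connection `e^α`,
`α = z₁^{−m}`: the de Rham complex induced by `φ`, `ψ` on `Q₂ = 𝔈/𝔏₂` has
cohomology of dimension `m` in degrees `0` and `1` and vanishes in degree `2`.
All statements about the induced maps are expressed via representatives. -/
theorem local_deRham_dim_one_direction (m : ℕ) (hm : 0 < m) :
    -- (i) φ and ψ preserve 𝔏₂, and ψ̄ ∘ φ̄ = 0
    (∀ f ∈ L2set, φ1 m f ∈ L2set ∧ φ2 f ∈ L2set) ∧
    (∀ f ∈ L2set, ∀ g ∈ L2set, ψop m f g ∈ L2set) ∧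
    (∀ u ∈ Esp, ψop m (φ1 m u) (φ2 u) ∈ L2set) ∧
    -- (ii) dim ker φ̄ = m
    (∃ K L : Submodule ℂ (ℂ × ℂ → ℂ),
      (∀ u : ℂ × ℂ → ℂ, u ∈ K ↔
        u ∈ Esp ∧ φ1 m u ∈ L2set ∧ φ2 u ∈ L2set) ∧
      (∀ u : ℂ × ℂ → ℂ, u ∈ L ↔ u ∈ L2set) ∧
      L ≤ K ∧
      Module.finrank ℂ (K ⧸ L.comap K.subtype) = m) ∧
    -- (iii) dim (ker ψ̄ / im φ̄) = m
    (∃ KP IP : Submodule ℂ ((ℂ × ℂ → ℂ) × (ℂ × ℂ → ℂ)),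
      (∀ ω : (ℂ × ℂ → ℂ) × (ℂ × ℂ → ℂ), ω ∈ KP ↔
        ω.1 ∈ Esp ∧ ω.2 ∈ Esp ∧ ψop m ω.1 ω.2 ∈ L2set) ∧
      (∀ ω : (ℂ × ℂ → ℂ) × (ℂ × ℂ → ℂ), ω ∈ IP ↔
        ω.1 ∈ Esp ∧ ω.2 ∈ Esp ∧ ∃ u ∈ Esp,
          ω.1 - φ1 m u ∈ L2set ∧ ω.2 - φ2 u ∈ L2set) ∧
      IP ≤ KP ∧
      Module.finrank ℂ (KP ⧸ IP.comap KP.subtype) = m) ∧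
    -- (iv) ψ̄ is surjective
    (∀ η ∈ Esp, ∃ ω₁ ∈ Esp, ∃ ω₂ ∈ Esp, η - ψop m ω₁ ω₂ ∈ L2set) := by
  exact ⟨fun f hf => ⟨φ1_mem_L2set hf, pd2_mem_L2set hf⟩,
    fun f hf g hg => ψop_mem_L2set hf hg, fun u hu => ψop_φ hu,
    ⟨kerφ m, l2Submodule, fun _ => Iff.rfl, fun _ => Iff.rfl,
      fun f hf => ⟨L2set_subset_Esp hf, φ1_mem_L2set hf, pd2_mem_L2set hf⟩,
      finrank_kerφ_quotient hm⟩,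
    ⟨kerψ m, imφ m, fun _ => Iff.rfl, fun _ => Iff.rfl, imφ_le_kerψ m,
      finrank_kerψ_quotient hm⟩,
    fun η hη => exists_sub_ψop_mem_L2set hm hη⟩
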